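/- arXiv:1309.6677 — 2 statements merged into one kernel-verified Lean document; each statement's English description precedes it below -/
import Mathlib

section
/- Let (Z, m) be a commutative Noetherian local ring which is m-adically complete, with residue field k, and let A be an Azumaya algebra over Z which is free of rank r² as a Z-module. If A/mA is isomorphic to the matrix algebra M_r(k) as a k-algebra, then A is isomorphic to M_r(Z) as a Z-algebra (i.e. A is split). -/
open scoped TensorProduct

/-- The natural map `A ⊗[Z] Aᵐᵒᵖ → End_Z(A)`, `a ⊗ b ↦ (c ↦ a·c·b)`. -/
noncomputable def azumayaMap (Z A : Type*) [CommRing Z] [Ring A] [Algebra Z A] :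
    A ⊗[Z] Aᵐᵒᵖ →ₗ[Z] Module.End Z A :=
  TensorProduct.lift <| LinearMap.mk₂ Z
    (fun a b => (LinearMap.mulLeft Z a) ∘ₗ (LinearMap.mulRight Z b.unop))
    (fun a a' b => by ext c; simp [add_mul])
    (fun z a b => by ext c; simp [smul_mul_assoc])
    (fun a b b' => by ext c; simp [mul_add])
    (fun z a b => by ext c; simp [mul_smul_comm])

/-- `A` is an Azumaya algebra over `Z`: a faithful finitely generated projective `Z`-module
such that the natural map `A ⊗[Z] Aᵐᵒᵖ → End_Z(A)` is an isomorphism. -/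
def IsAzumayaOver (Z A : Type*) [CommRing Z] [Ring A] [Algebra Z A] : Prop :=
  FaithfulSMul Z A ∧ Module.Finite Z A ∧ Module.Projective Z A ∧
    Function.Bijective (azumayaMap Z A)

section Helpers

variable {Z A : Type*} [CommRing Z] [Ring A] [Algebra Z A]

lemma azh_functional_mem {M : Type*} [AddCommGroup M] [Module Z M] (J : Ideal Z)
    (φ : M →ₗ[Z] Z) {x : M} (hx : x ∈ J • (⊤ : Submodule Z M)) : φ x ∈ J := by
  refine Submodule.smul_induction_on hx ?_ ?_
  · intro z hz y _
    rw [map_smul, smul_eq_mul]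
    exact J.mul_mem_right _ hz
  · intro x y hx hy
    rw [map_add]
    exact J.add_mem hx hy

lemma azh_mem_of_coords {M ι : Type*} [AddCommGroup M] [Module Z M] [Fintype ι] (J : Ideal Z)
    (b : Module.Basis ι Z M) {x : M} (hx : ∀ i, b.repr x i ∈ J) :
    x ∈ J • (⊤ : Submodule Z M) := by
  rw [← b.sum_repr x]
  exact Submodule.sum_mem _ fun i _ => Submodule.smul_mem_smul (hx i) trivial

lemma azh_precomplete {M : Type*} [AddCommGroup M] [Module Z M] (J : Ideal Z) [IsPrecomplete J Z]
    [Module.Free Z M] [Module.Finite Z M] : IsPrecomplete J M := by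
  refine ⟨fun f hf => ?_⟩
  let b := Module.Free.chooseBasis Z M
  have key : ∀ i, ∃ L : Z, ∀ n, b.coord i (f n) ≡ L [SMOD (J ^ n • ⊤ : Submodule Z Z)] := by
    intro i
    refine IsPrecomplete.prec' _ ?_
    intro m n hmn
    have h := hf hmn
    rw [SModEq.sub_mem] at h ⊢
    have := azh_functional_mem _ (b.coord i) h
    rw [map_sub] at this
    simpa using this
  choose L hL using key
  refine ⟨∑ i, L i • b i, fun n => ?_⟩
  rw [SModEq.sub_mem]
  refine azh_mem_of_coords _ b fun i => ?_
  have := hL i n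
  rw [SModEq.sub_mem] at this
  simpa [Finsupp.single_apply] using this

lemma azh_mul_left {J : Ideal Z} {x : A} (a : A) (hx : x ∈ J • (⊤ : Submodule Z A)) :
    a * x ∈ J • (⊤ : Submodule Z A) := by
  refine Submodule.smul_induction_on hx ?_ ?_
  · intro z hz y _
    rw [mul_smul_comm]
    exact Submodule.smul_mem_smul hz trivial
  · intro x y hx hy
    rw [mul_add]
    exact Submodule.add_mem _ hx hy

lemma azh_mul_mem {J K : Ideal Z} {x y : A} (hx : x ∈ J • (⊤ : Submodule Z A))
    (hy : y ∈ K • (⊤ : Submodule Z A)) : x * y ∈ (J * K) • (⊤ : Submodule Z A) := by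
  refine Submodule.smul_induction_on hx ?_ ?_
  · intro z hz w _
    rw [Submodule.mul_smul, smul_mul_assoc]
    exact Submodule.smul_mem_smul hz (azh_mul_left w hy)
  · intro x x' hx hx'
    rw [add_mul]
    exact Submodule.add_mem _ hx hx'

lemma azh_mul_right {J : Ideal Z} {x : A} (a : A) (hx : x ∈ J • (⊤ : Submodule Z A)) :
    x * a ∈ J • (⊤ : Submodule Z A) := by
  have := azh_mul_mem (K := ⊤) (y := a) hx (by simp)
  simpa using this

lemma azh_map_le (J : Ideal Z) {x : A} (hx : x ∈ Ideal.map (algebraMap Z A) J) :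
    x ∈ J • (⊤ : Submodule Z A) := by
  refine Submodule.span_induction ?_ ?_ ?_ ?_ hx
  · rintro _ ⟨z, hz, rfl⟩
    rw [Algebra.algebraMap_eq_smul_one]
    exact Submodule.smul_mem_smul hz trivial
  · exact Submodule.zero_mem _
  · intro x y _ _ hx hy
    exact Submodule.add_mem _ hx hy
  · intro a x _ hx
    exact azh_mul_left a hx

/-- Idempotent lifting by Newton iteration. -/
lemma azh_lift_idem (J : Ideal Z) [IsPrecomplete J A] [IsHausdorff J A] (a : A)
    (ha : a * a - a ∈ J • (⊤ : Submodule Z A)) :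
    ∃ e : A, e * e = e ∧ e - a ∈ J • (⊤ : Submodule Z A) := by
  let N : A → A := fun x => 3 * (x * x) - 2 * (x * x * x)
  let s : ℕ → A := fun n => N^[n] a
  have hs : ∀ n, s (n + 1) = N (s n) := fun n => Function.iterate_succ_apply' N n a
  have h1 : ∀ n, s n * s n - s n ∈ J ^ (n + 1) • (⊤ : Submodule Z A) := by
    intro n
    induction n with
    | zero => simpa [s] using ha
    | succ n ih =>
      rw [hs]
      set x := s n
      have e1 : N x * N x - N x = (4 * (x * x - x) - 3) * ((x * x - x) * (x * x - x)) := by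
        simp only [N]; noncomm_ring
      rw [e1]
      refine azh_mul_left _ ?_
      have := azh_mul_mem ih ih
      refine Submodule.smul_mono_left ?_ this
      rw [← pow_add]
      exact Ideal.pow_le_pow_right (by omega)
  have h2 : ∀ n, s (n + 1) - s n ∈ J ^ (n + 1) • (⊤ : Submodule Z A) := by
    intro n
    rw [hs]
    have e1 : N (s n) - s n = (1 - 2 * s n) * (s n * s n - s n) := by
      simp only [N]; noncomm_ring
    rw [e1]
    exact azh_mul_left _ (h1 n)
  have h3 : ∀ n k, s (n + k) - s n ∈ J ^ (n + 1) • (⊤ : Submodule Z A) := by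
    intro n k
    induction k with
    | zero => simp
    | succ k ih =>
      have : s (n + (k + 1)) - s n = (s (n + k + 1) - s (n + k)) + (s (n + k) - s n) := by
        rw [← add_assoc]; abel
      rw [this]
      refine Submodule.add_mem _ (Submodule.smul_mono_left ?_ (h2 (n + k))) ih
      exact Ideal.pow_le_pow_right (by omega)
  have hle : ∀ n, J ^ (n + 1) • (⊤ : Submodule Z A) ≤ J ^ n • (⊤ : Submodule Z A) := fun n =>
    Submodule.smul_mono_left (Ideal.pow_le_pow_right (by omega))
  obtain ⟨e, he⟩ := IsPrecomplete.prec' (I := J) s (by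
    intro m n hmn
    obtain ⟨k, rfl⟩ := Nat.exists_eq_add_of_le hmn
    refine SModEq.symm ?_
    rw [SModEq.sub_mem]
    exact hle _ (h3 m k))
  have he' : ∀ n, e - s n ∈ J ^ n • (⊤ : Submodule Z A) := fun n => by
    have := (he n).symm
    rwa [SModEq.sub_mem] at this
  refine ⟨e, ?_, ?_⟩
  · rw [← sub_eq_zero]
    refine IsHausdorff.haus' (I := J) _ fun n => ?_
    rw [SModEq.zero]
    have : e * e - e = e * (e - s n) + (e - s n) * s n + (s n * s n - s n) - (e - s n) := by
      noncomm_ring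
    rw [this]
    exact Submodule.sub_mem _ (Submodule.add_mem _ (Submodule.add_mem _
      (azh_mul_left _ (he' n)) (azh_mul_right _ (he' n))) (hle _ (h1 n))) (he' n)
  · have : e - a = (e - s 1) + (s 1 - s 0) := by simp [s]
    rw [this]
    refine Submodule.add_mem _ ?_ ?_
    · simpa using he' 1
    · simpa using h2 0

universe uZ

lemma azh_li {R : Type uZ} {P : Type*} [CommRing R] [IsLocalRing R] [AddCommGroup P] [Module R P]
    [Module.Flat R P] {r : ℕ} (g : P →ₗ[R] (Fin r → IsLocalRing.ResidueField R)) (v : Fin r → P)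
    (hgv : ∀ i, g (v i) = Pi.single i 1) : LinearIndependent R v := by
  let E : ULift.{uZ} (Fin r) ≃ Fin r := Equiv.ulift
  have h0 : LinearIndependent R (v ∘ E) := by
    apply Module.IsLocalRing.linearIndependent_of_flat
    refine LinearIndependent.of_comp (LinearMap.liftBaseChange (IsLocalRing.ResidueField R) g) ?_
    have h1 := Pi.linearIndependent_single_one (Fin r) (IsLocalRing.ResidueField R)
    have h2 := h1.comp _ E.injective
    convert h2 using 1
    ext1 i
    simp [hgv]
  exact (linearIndependent_equiv _).1 h0

end Helpers

theorem azumaya_split_of_split_residue {Z A : Type*} [CommRing Z] [IsNoetherianRing Z]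
    [IsLocalRing Z] [IsAdicComplete (IsLocalRing.maximalIdeal Z) Z]
    [Ring A] [Algebra Z A] (r : ℕ) (hr : 1 ≤ r)
    (haz : IsAzumayaOver Z A) [Module.Free Z A]
    (hrank : Module.finrank Z A = r ^ 2)
    (hres : ∃ f : A →ₐ[Z] Matrix (Fin r) (Fin r) (IsLocalRing.ResidueField Z),
      Function.Surjective f ∧
      RingHom.ker (f : A →+* Matrix (Fin r) (Fin r) (IsLocalRing.ResidueField Z)) =
        Ideal.map (algebraMap Z A) (IsLocalRing.maximalIdeal Z)) :
    Nonempty (A ≃ₐ[Z] Matrix (Fin r) (Fin r) Z) := by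
  classical
  obtain ⟨-, hfin, -, -⟩ := haz
  obtain ⟨f, hf, hker⟩ := hres
  set m := IsLocalRing.maximalIdeal Z with hm
  set k := IsLocalRing.ResidueField Z with hk
  have hres_zero : ∀ z ∈ m, algebraMap Z k z = 0 := fun z hz =>
    (IsLocalRing.residue_eq_zero_iff z).2 hz
  have hk1 : ∀ x, f x = 0 → x ∈ m • (⊤ : Submodule Z A) := by
    intro x hx
    refine azh_map_le m ?_
    rw [← hker]
    exact hx
  have hk2 : ∀ x ∈ m • (⊤ : Submodule Z A), f x = 0 := by
    intro x hx
    refine Submodule.smul_induction_on hx ?_ ?_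
    · intro z hz y _
      rw [map_smul, ← algebraMap_smul k z (f y), hres_zero z hz, zero_smul]
    · intro x y hx hy
      rw [map_add, hx, hy, add_zero]
  haveI : IsPrecomplete m A := azh_precomplete m
  let i₀ : Fin r := ⟨0, hr⟩
  obtain ⟨a, ha⟩ := hf (Matrix.single i₀ i₀ 1)
  obtain ⟨e, he, hea⟩ := azh_lift_idem m a (hk1 _ (by simp [ha]))
  have hfe : f e = Matrix.single i₀ i₀ 1 := by
    have := hk2 _ hea
    rwa [map_sub, sub_eq_zero, ha] at this
  -- the left ideal `P = A e`
  let P : Submodule Z A := LinearMap.range (LinearMap.mulRight Z e)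
  have hP : ∀ x : P, (x : A) * e = x := by
    rintro ⟨_, y, rfl⟩
    simp [mul_assoc, he]
  let pr : A →ₗ[Z] P := (LinearMap.mulRight Z e).rangeRestrict
  have hpr : ∀ x : A, (pr x : A) = x * e := fun x => rfl
  haveI : Module.Projective Z P := Module.Projective.of_split P.subtype pr (by
    ext x
    simpa [hpr] using hP x)
  choose c hc using fun i : Fin r => hf (Matrix.single i i₀ 1)
  let v : Fin r → P := fun i => pr (c i)
  have hv : ∀ i, f (v i) = Matrix.single i i₀ 1 := by
    intro i
    simp [v, hpr, hc, hfe]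
  -- first column
  let g : P →ₗ[Z] (Fin r → k) :=
    { toFun := fun x i => f x i i₀
      map_add' := by intro x y; ext i; simp
      map_smul' := by intro z x; ext i; simp }
  have hgv : ∀ i, g (v i) = Pi.single i 1 := by
    intro i
    ext j
    simp [g, hv, Matrix.single_apply, Pi.single_apply, eq_comm]
  have hg0 : ∀ x : P, g x = 0 → x ∈ m • (⊤ : Submodule Z P) := by
    intro x hx
    have h0 : f x = 0 := by
      rw [← hP x, map_mul, hfe]
      ext i j
      have := congrFun hx i
      by_cases hj : j = i₀
      · subst hj
        simpa [g] using this
      · simp [Matrix.mul_single_apply_of_ne, hj]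
    have h1 := hk1 _ h0
    have h2 : pr x ∈ (m • (⊤ : Submodule Z A)).map pr := Submodule.mem_map_of_mem h1
    rw [Submodule.map_smul''] at h2
    have h3 : pr x = x := Subtype.ext (hP x)
    rw [h3] at h2
    exact Submodule.smul_mono le_rfl le_top h2
  have hspan : ⊤ ≤ Submodule.span Z (Set.range v) := by
    refine Submodule.le_of_le_smul_of_le_jacobson_bot (I := m) Module.Finite.fg_top
      (IsLocalRing.maximalIdeal_le_jacobson _) ?_
    intro x _
    choose z hz using fun i => IsLocalRing.residue_surjective (g x i)
    have hz' : ∀ i, algebraMap Z k (z i) = g x i := hz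
    have : x = (∑ i, z i • v i) + (x - ∑ i, z i • v i) := by abel
    rw [this]
    refine Submodule.add_mem_sup (Submodule.sum_mem _ fun i _ =>
      Submodule.smul_mem _ _ (Submodule.subset_span ⟨i, rfl⟩)) (hg0 _ ?_)
    rw [map_sub, map_sum, sub_eq_zero]
    ext j
    simp [hgv, Pi.single_apply, Algebra.smul_def, hz']
  have hli : LinearIndependent Z v := by
    exact azh_li g v hgv
  let b : Module.Basis (Fin r) Z P := Module.Basis.mk hli hspan
  have hb : ∀ i, b i = v i := fun i => Module.Basis.mk_apply _ _ i
  let L : A →ₐ[Z] Module.End Z P := AlgHom.ofLinearMap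
    { toFun := fun x => pr ∘ₗ LinearMap.mulLeft Z x ∘ₗ P.subtype
      map_add' := by intro x y; ext p; simp [hpr, add_mul]
      map_smul' := by intro z x; ext p; simp [hpr] }
    (by ext p; simp [hpr, hP])
    (by intro x y; ext p; simp [hpr, hP, mul_assoc, he])
  have hL : ∀ x (p : P), (L x p : A) = x * p := by
    intro x p
    change x * p * e = x * p
    rw [mul_assoc, hP]
  let Φ : A →ₐ[Z] Matrix (Fin r) (Fin r) Z := (LinearMap.toMatrixAlgEquiv b).toAlgHom.comp L
  have hΦ : ∀ x i j, algebraMap Z k (Φ x i j) = f x i j := by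
    intro x i j
    have h1 : L x (b j) = ∑ i, Φ x i j • b i := by
      rw [← b.sum_repr (L x (b j))]
      simp [Φ, LinearMap.toMatrixAlgEquiv_apply]
    have h2 : g (L x (b j)) i = f x i j := by
      simp [g, hL, hb, hv]
    rw [← h2, h1]
    simp [hb, hgv, Pi.single_apply, Algebra.smul_def]
  have hsurj : Function.Surjective Φ.toLinearMap := by
    rw [← LinearMap.range_eq_top, eq_top_iff]
    refine Submodule.le_of_le_smul_of_le_jacobson_bot (I := m) Module.Finite.fg_top
      (IsLocalRing.maximalIdeal_le_jacobson _) ?_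
    intro M _
    obtain ⟨x, hx⟩ := hf (M.map (algebraMap Z k))
    have : M = Φ x + (M - Φ x) := by abel
    rw [this]
    refine Submodule.add_mem_sup ⟨x, rfl⟩ ?_
    refine azh_mem_of_coords m (Matrix.stdBasis Z (Fin r) (Fin r)) ?_
    rintro ⟨i, j⟩
    have h1 : algebraMap Z k (M i j - Φ x i j) = 0 := by
      rw [map_sub, hΦ, hx]
      simp
    exact (IsLocalRing.residue_eq_zero_iff _).1 h1
  have hbij : Function.Bijective Φ.toLinearMap := by
    refine OrzechProperty.bijective_of_surjective_of_finrank_le _ hsurj ?_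
    simp [hrank, Module.finrank_matrix, sq]
  exact ⟨AlgEquiv.ofBijective Φ hbij⟩
end

section
/- Let k be a field of characteristic p > 0 and let A be a k-algebra which is an Azumaya algebra over its center Z, where Z is a finitely generated commutative k-algebra that is regular (all localizations of Z at prime ideals are regular local rings), and A has constant rank r² over Z with r = p^n for some n ≥ 0. Let (A', h, π) be a first order deformation of A, with induced bracket {−, −} on Z. Let M be a finitely generated left A-module admitting a first order A'-deformation M', and let I = rad(Ann_Z M) be the radical of the annihilator of M in Z. Assume that for every minimal prime q of Z over Ann_Z M, the length of the localization M_q over Z_q is of the form b·p^n with b not divisible by p. Then I is coisotropic: {I, I} ⊆ I. -/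
open scoped TensorProduct

/-- `(A', h, π)` is a first order deformation of `A`: `h` is a central element of `A'`,
`π : A' → A` is a surjective ring homomorphism with kernel `hA'`, and the annihilator
`{x ∈ A' : h·x = 0}` equals `hA'`. -/
def IsFirstOrderDeformation {A' A : Type*} [Ring A'] [Ring A] (h : A') (π : A' →+* A) : Prop :=
  (∀ x : A', h * x = x * h) ∧
  Function.Surjective π ∧
  (∀ x : A', π x = 0 ↔ ∃ y : A', x = h * y) ∧
  (∀ x : A', h * x = 0 ↔ ∃ y : A', x = h * y)

/-- Given a first order deformation `(A', h, π)` of `A`, an `A`-module `M` and an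
`A'`-module `M'`, the additive map `q : M' → M` exhibits `M'` as a first order
`A'`-deformation of `M`: `q` is surjective and `π`-equivariant, its kernel is `h·M'`
(so `M'/hM' ≅ M`), and the annihilator of `h` in `M'` is `h·M'`. -/
def IsModuleDeformation {A' A : Type*} [Ring A'] [Ring A] (h : A') (π : A' →+* A)
    {M' M : Type*} [AddCommGroup M'] [Module A' M'] [AddCommGroup M] [Module A M]
    (q : M' →+ M) : Prop :=
  Function.Surjective q ∧
  (∀ (a : A') (x : M'), q (a • x) = π a • q x) ∧
  (∀ x : M', q x = 0 ↔ ∃ y : M', x = h • y) ∧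
  (∀ x : M', h • x = 0 ↔ ∃ y : M', x = h • y)

/-- A module `M` over `R` has (Jordan–Hölder) length `n` if it admits a composition series
of length `n` from `⊥` to `⊤`. -/
def HasModuleLength (R M : Type*) [Ring R] [AddCommGroup M] [Module R M] (n : ℕ) : Prop :=
  ∃ s : CompositionSeries (Submodule R M), s.head = ⊥ ∧ s.last = ⊤ ∧ s.length = n

/-- A local ring is regular if it is Noetherian and its maximal ideal is generated by
`dim R` elements. -/
def IsRegularLocalRingPred (R : Type*) [CommRing R] [IsLocalRing R] : Prop :=
  IsNoetherianRing R ∧ ∃ s : Finset R,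
    Ideal.span (s : Set R) = IsLocalRing.maximalIdeal R ∧
    (s.card : WithBot (WithTop ℕ)) = ringKrullDim R

universe uu

theorem sqzero_section {p : ℕ} (hp : p.Prime) {B κ : Type*} [CommRing B] [Field κ]
    (hpB : (p : B) = 0) (I : Ideal B) (hI : I ^ 2 = ⊥) (g : κ →+* B ⧸ I) :
    ∃ f : κ →+* B, (Ideal.Quotient.mk I).comp f = g := by
  classical
  have := Fact.mk hp
  rcases subsingleton_or_nontrivial (B ⧸ I) with hsub | hnt
  · have hB : Subsingleton B := by
      have : I = ⊤ := Ideal.Quotient.subsingleton_iff.mp hsub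
      have h1 : (1 : B) ∈ I ^ 2 := by rw [this, Ideal.top_pow]; exact Submodule.mem_top
      rw [hI] at h1
      exact subsingleton_of_zero_eq_one (by simpa using h1.symm)
    exact ⟨{ toFun := fun _ => 0
             map_one' := Subsingleton.elim _ _
             map_mul' := fun _ _ => Subsingleton.elim _ _
             map_zero' := rfl
             map_add' := fun _ _ => Subsingleton.elim _ _ },
           RingHom.ext fun _ => Subsingleton.elim _ _⟩
  have : Nontrivial B := (Ideal.Quotient.mk I).domain_nontrivial
  have : CharP B p := (CharP.charP_iff_prime_eq_zero hp).mpr hpB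
  have : CharP (B ⧸ I) p := (CharP.charP_iff_prime_eq_zero hp).mpr (by
    rw [← map_natCast (Ideal.Quotient.mk I), hpB, map_zero])
  have hg : Function.Injective g := g.injective
  have : CharP κ p := (CharP.charP_iff_prime_eq_zero hp).mpr (hg (by simp))
  have hsq : ∀ x ∈ I, x ^ p = 0 := by
    intro x hx
    have : x ^ 2 ∈ I ^ 2 := Ideal.pow_mem_pow hx 2
    rw [hI, Ideal.mem_bot] at this
    exact pow_eq_zero_of_le hp.two_le this
  let mk := Ideal.Quotient.mk I
  let Λ : Subring B := g.range.comap mk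
  let S : Set (Subring B) := {T | T ≤ Λ ∧ ∀ x ∈ T, x ∈ I → x = 0}
  have hT0 : Λ.map (frobenius B p) ∈ S := by
    constructor
    · rintro _ ⟨x, hx, rfl⟩
      exact Λ.pow_mem hx p
    · rintro _ ⟨x, hx, rfl⟩ hxI
      obtain ⟨y, hy⟩ := hx
      have h1 : g (y ^ p) = 0 := by
        rw [map_pow, hy, ← map_pow]
        exact Ideal.Quotient.eq_zero_iff_mem.mpr hxI
      have h2 : y = 0 := pow_eq_zero_iff hp.ne_zero |>.mp (hg (by rw [h1, map_zero]))
      rw [h2, map_zero] at hy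
      exact hsq x (Ideal.Quotient.eq_zero_iff_mem.mp hy.symm)
  obtain ⟨T, hT0T, hTmax⟩ := zorn_le_nonempty₀ S (by
    intro c hc hchain y hy
    refine ⟨sSup c, ⟨sSup_le fun T hT => (hc hT).1, ?_⟩, fun z hz => le_sSup hz⟩
    intro x hx hxI
    rw [Subring.mem_sSup_of_directedOn ⟨y, hy⟩ hchain.directedOn] at hx
    obtain ⟨T, hT, hxT⟩ := hx
    exact (hc hT).2 x hxT hxI) _ hT0
  obtain ⟨⟨hTΛ, hTI⟩, hmax⟩ := hTmax
  let ginv : g.range ≃+* κ := (RingEquiv.ofBijective g.rangeRestrict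
    ⟨fun a b hab => hg (congrArg Subtype.val hab), g.rangeRestrict_surjective⟩).symm
  let θ : T →+* κ := ginv.toRingHom.comp ((mk.comp T.subtype).codRestrict g.range (fun t => hTΛ t.2))
  have hθ : ∀ t : T, g (θ t) = mk (t : B) := by
    intro t
    exact congrArg Subtype.val (ginv.symm_apply_apply ((mk.comp T.subtype).codRestrict g.range (fun t => hTΛ t.2) t))
  have hθinj : Function.Injective θ := by
    rw [injective_iff_map_eq_zero]
    intro t ht
    have := hθ t
    rw [ht, map_zero] at this
    exact Subtype.ext (hTI t t.2 (Ideal.Quotient.eq_zero_iff_mem.mp this.symm))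
  have hppow : ∀ z : B, z ∈ Λ → z ^ p ∈ T := fun z hz => hT0T ⟨z, hz, rfl⟩
  have hθp : ∀ y : κ, y ^ p ∈ θ.range := by
    intro y
    obtain ⟨x, hx⟩ := Ideal.Quotient.mk_surjective (g y)
    have hxΛ : x ∈ Λ := ⟨y, hx.symm⟩
    refine ⟨⟨x ^ p, hppow x hxΛ⟩, hg ?_⟩
    rw [hθ]; simp [mk, hx]
  have hsurj : Function.Surjective θ := by
    by_contra hns
    simp only [Function.Surjective, not_forall] at hns
    obtain ⟨y, hy⟩ := hns
    obtain ⟨x, hx⟩ := Ideal.Quotient.mk_surjective (g y)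
    have hxΛ : x ∈ Λ := ⟨y, hx.symm⟩
    let F : Subfield κ := { θ.range with
      inv_mem' := by
        intro u hu
        change u⁻¹ ∈ θ.range
        by_cases h0 : u = 0
        · rw [h0, inv_zero]; exact zero_mem _
        have : u⁻¹ = u ^ (p - 1) * (u⁻¹) ^ p := by
          rw [inv_pow, ← div_eq_mul_inv, eq_div_iff (pow_ne_zero _ h0), inv_mul_eq_iff_eq_mul₀ h0,
            ← pow_succ', Nat.sub_add_cancel hp.one_le]
        rw [this]
        exact mul_mem (pow_mem hu _) (hθp _) }
    let θF : T →+* F := θ.codRestrict F (fun t => ⟨t, rfl⟩)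
    let yp : F := ⟨y ^ p, hθp y⟩
    have hirr : Irreducible (Polynomial.X ^ p - Polynomial.C yp) := by
      apply X_pow_sub_C_irreducible_of_prime hp
      rintro ⟨b, hb⟩ hbe
      have h1 : b ^ p = y ^ p := congrArg Subtype.val hbe
      have h2 : b = y := frobenius_inj κ p h1
      obtain ⟨t, ht⟩ := hb
      exact hy ⟨t, ht.trans h2⟩
    have hmin : minpoly F y = Polynomial.X ^ p - Polynomial.C yp := by
      refine (minpoly.eq_of_irreducible_of_monic hirr ?_ (Polynomial.monic_X_pow_sub_C _ hp.ne_zero)).symm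
      simp [yp, Subfield.algebraMap_ofSubfield, Algebra.algebraMap_eq_smul_one, Subfield.smul_def]
    let T2 : Subring B := (Polynomial.eval₂RingHom T.subtype x).range
    have hT2 : T2 ∈ S := by
      constructor
      · rintro _ ⟨P, rfl⟩
        simp only [Polynomial.coe_eval₂RingHom, Polynomial.eval₂_eq_sum_range]
        exact sum_mem fun i _ => mul_mem (hTΛ (P.coeff i).2) (pow_mem hxΛ i)
      · rintro _ ⟨P, rfl⟩ hPI
        let xp : T := ⟨x ^ p, hppow x hxΛ⟩
        have hmon : (Polynomial.X ^ p - Polynomial.C xp).Monic := Polynomial.monic_X_pow_sub_C _ hp.ne_zero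
        let r := P %ₘ (Polynomial.X ^ p - Polynomial.C xp)
        have hr : Polynomial.eval₂ T.subtype x P = Polynomial.eval₂ T.subtype x r := by
          conv_lhs => rw [← Polynomial.modByMonic_add_div P (Polynomial.X ^ p - Polynomial.C xp)]
          rw [Polynomial.eval₂_add, Polynomial.eval₂_mul]
          simp [r, xp]
        simp only [Polynomial.coe_eval₂RingHom] at hPI ⊢
        rw [hr] at hPI ⊢
        have hdeg : r.degree < p := by
          have := Polynomial.degree_modByMonic_lt P hmon
          rwa [Polynomial.degree_X_pow_sub_C hp.pos] at this
        have hry : Polynomial.aeval y (r.map θF) = 0 := by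
          rw [Polynomial.aeval_def, Polynomial.eval₂_map]
          apply hg
          rw [Polynomial.hom_eval₂, map_zero, ← hx]
          have : (g.comp ((algebraMap F κ).comp θF)) = mk.comp T.subtype := by
            ext t; exact hθ t
          rw [this, ← Polynomial.hom_eval₂]
          exact Ideal.Quotient.eq_zero_iff_mem.mpr hPI
        have hr0 : r.map θF = 0 := by
          by_contra hne
          have := minpoly.degree_le_of_ne_zero F y hne hry
          rw [hmin, Polynomial.degree_X_pow_sub_C hp.pos] at this
          exact absurd (lt_of_le_of_lt (this.trans Polynomial.degree_map_le) hdeg) (lt_irrefl _)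
        have hθFinj : Function.Injective θF := fun a b hab => hθinj (congrArg Subtype.val hab)
        have : r = 0 := (Polynomial.map_eq_zero_iff hθFinj).mp hr0
        rw [this]; simp
    have hle : T ≤ T2 := fun t ht => ⟨Polynomial.C ⟨t, ht⟩, by simp⟩
    have hxT2 : x ∈ T2 := ⟨Polynomial.X, by simp⟩
    have hxT : x ∈ T := hmax hT2 hle hxT2
    exact hy ⟨⟨x, hxT⟩, hg (by rw [hθ]; exact hx)⟩
  let e : T ≃+* κ := RingEquiv.ofBijective θ ⟨hθinj, hsurj⟩
  refine ⟨T.subtype.comp e.symm.toRingHom, ?_⟩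
  ext y
  have := hθ (e.symm y)
  have h2 : θ (e.symm y) = y := e.apply_symm_apply y
  rw [h2] at this
  exact this.symm

theorem nilp_section {p : ℕ} (hp : p.Prime) {B κ : Type*} [CommRing B] [Field κ]
    (hpB : (p : B) = 0) (I : Ideal B) (hI : IsNilpotent I) (g : κ →+* B ⧸ I) :
    ∃ f : κ →+* B, (Ideal.Quotient.mk I).comp f = g := by
  revert g hpB
  apply Ideal.IsNilpotent.induction_on (S := B) I hI
  · intro B _ I hI hpB g
    exact sqzero_section hp hpB I hI g
  · intro B _ I J hIJ h₁ h₂ hpB g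
    let e : ((B ⧸ I) ⧸ J.map (Ideal.Quotient.mk I)) ≃+* B ⧸ J :=
      (DoubleQuot.quotQuotEquivQuotSup I J).trans
          (Ideal.quotEquivOfEq (sup_eq_right.mpr hIJ))
    obtain ⟨g', hg'⟩ := h₂ (by rw [← map_natCast (Ideal.Quotient.mk I), hpB, map_zero]) (e.symm.toRingHom.comp g)
    obtain ⟨f, hf⟩ := h₁ hpB g'
    refine ⟨f, ?_⟩
    ext y
    have h1 : Ideal.Quotient.mk I (f y) = g' y := congrArg (· y) hf
    have h2 : Ideal.Quotient.mk _ (g' y) = e.symm (g y) := congrArg (· y) hg'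
    have h3 : e (Ideal.Quotient.mk _ (g' y)) = g y := by rw [h2]; simp
    rw [← h3, ← h1]
    rfl

theorem exists_triangular_basis {K Λ : Type*} [Field K] [CommRing Λ] [Algebra K Λ]
    (𝔫 : Ideal Λ) (hnil : IsNilpotent 𝔫) (hK : ∀ l : Λ, ∃ c : K, l - algebraMap K Λ c ∈ 𝔫)
    (n : ℕ) : ∀ (N : Type*) [AddCommGroup N] [Module K N] [Module Λ N] [IsScalarTower K Λ N]
    [Module.Finite K N], Module.finrank K N = n →
    ∃ b : Module.Basis (Fin n) K N, ∀ ν ∈ 𝔫, ∀ i j, i ≤ j → b.repr (ν • b j) i = 0 := by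
  induction n with
  | zero =>
    intro N _ _ _ _ _ hN
    exact ⟨Module.finBasisOfFinrankEq K N hN, fun ν _ i => i.elim0⟩
  | succ n ih =>
    intro N _ _ _ _ _ hN
    obtain ⟨G, hGm⟩ : ∃ G : Submodule K N, ∀ x, x ∈ G ↔ x ∈ 𝔫 • (⊤ : Submodule Λ N) :=
      ⟨(𝔫 • (⊤ : Submodule Λ N)).restrictScalars K, fun x => Iff.rfl⟩
    have hG : G ≠ ⊤ := by
      intro hG
      have h1 : 𝔫 • (⊤ : Submodule Λ N) = ⊤ := by
        ext x; simp only [Submodule.mem_top, iff_true]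
        have : x ∈ G := by rw [hG]; trivial
        exact (hGm x).mp this
      obtain ⟨k, hk⟩ := hnil
      have h2 : ∀ m : ℕ, 𝔫 ^ m • (⊤ : Submodule Λ N) = ⊤ := by
        intro m
        induction m with
        | zero => simp
        | succ m ihm => rw [pow_succ, Submodule.mul_smul, h1, ihm]
      have h3 := h2 k
      rw [hk, Submodule.zero_eq_bot, Submodule.bot_smul] at h3
      have : Subsingleton N := Submodule.subsingleton_iff Λ |>.mp (subsingleton_of_bot_eq_top h3)
      have := Module.finrank_zero_of_subsingleton (R := K) (M := N)
      omega
    obtain ⟨H, hHco, hGH⟩ := (eq_top_or_exists_le_coatom G).resolve_left hG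
    have hnH : ∀ ν ∈ 𝔫, ∀ x : N, ν • x ∈ H := fun ν hν x =>
      hGH ((hGm _).mpr (Submodule.smul_mem_smul hν (Submodule.mem_top)))
    let HΛ : Submodule Λ N :=
      { H with
        smul_mem' := by
          intro l x hx
          obtain ⟨c, hc⟩ := hK l
          have : l • x = (l - algebraMap K Λ c) • x + c • x := by
            rw [sub_smul, algebraMap_smul]; abel
          change l • x ∈ H
          rw [this]
          exact H.add_mem (hnH _ hc x) (H.smul_mem c hx) }
    have hsimple : IsSimpleModule K (N ⧸ H) := isSimpleModule_iff_isCoatom.mpr hHco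
    have hfr : Module.finrank K (N ⧸ H) = 1 := by
      have := Module.length_eq_one K (N ⧸ H)
      rw [Module.length_eq_finrank] at this
      exact_mod_cast this
    have hfH : Module.finrank K H = n := by
      have := H.finrank_quotient_add_finrank
      omega
    let eH : HΛ ≃ₗ[K] H := { toFun := fun x => ⟨x.1, x.2⟩, invFun := fun x => ⟨x.1, x.2⟩,
                             map_add' := fun _ _ => rfl, map_smul' := fun _ _ => rfl,
                             left_inv := fun _ => rfl, right_inv := fun _ => rfl }
    have : Module.Finite K HΛ := Module.Finite.equiv eH.symm
    obtain ⟨b, hb⟩ := ih HΛ (by rw [eH.finrank_eq, hfH])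
    obtain ⟨y, hy⟩ : ∃ y, y ∉ H := by
      by_contra! hcon
      exact hHco.1 (eq_top_iff.mpr fun x _ => hcon x)
    let bH : Module.Basis (Fin n) K H := b.map eH
    have hli : ∀ (c : K), ∀ x ∈ H, c • y + x = 0 → c = 0 := by
      intro c x hx hcx
      by_contra hc
      apply hy
      have : c • y ∈ H := by
        rw [eq_neg_of_add_eq_zero_left hcx]; exact H.neg_mem hx
      exact (H.smul_mem_iff hc).mp this
    have hsp : ∀ z : N, ∃ c : K, z + c • y ∈ H := by
      intro z
      have h1 : H ⊔ K ∙ y = ⊤ := hHco.2 _ (by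
        rw [left_lt_sup]; intro hle
        exact hy (hle (Submodule.mem_span_singleton_self y)))
      have h2 : z ∈ H ⊔ K ∙ y := by rw [h1]; trivial
      obtain ⟨u, hu, v, hv, huv⟩ := Submodule.mem_sup.mp h2
      obtain ⟨c, rfl⟩ := Submodule.mem_span_singleton.mp hv
      exact ⟨-c, by rw [← huv]; simpa using hu⟩
    let B := Module.Basis.mkFinCons y bH hli hsp
    have hB0 : B 0 = y := by simp [B]
    have hBs : ∀ i : Fin n, B i.succ = (b i : N) := by intro i; simp [B, bH, eH]
    have hrep : ∀ x : HΛ, B.repr (x : N) 0 = 0 ∧ ∀ i : Fin n, B.repr (x : N) i.succ = b.repr x i := by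
      intro x
      have hx : (x : N) = ∑ i, b.repr x i • B i.succ := by
        have h := congrArg HΛ.subtype (b.sum_repr x).symm
        rw [map_sum] at h
        exact h.trans (Finset.sum_congr rfl fun i _ => by rw [hBs]; rfl)
      rw [hx]
      constructor
      · simp [map_sum, Finsupp.single_apply]
      · intro i
        simp [map_sum, Finsupp.single_apply]
    refine ⟨B, ?_⟩
    intro ν hν i j hij
    have hmem : ν • B j ∈ HΛ := hnH ν hν _
    induction i using Fin.cases with
    | zero => exact (hrep ⟨_, hmem⟩).1
    | succ i =>
      induction j using Fin.cases with
      | zero => simp at hij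
      | succ j =>
        rw [(hrep ⟨_, hmem⟩).2 i]
        have : (⟨ν • B j.succ, hmem⟩ : HΛ) = ν • b j := Subtype.ext (by simp [hBs])
        rw [this]
        exact hb ν hν i j (Fin.succ_le_succ_iff.mp hij)

theorem core_trace {K Λ Γ N N' : Type*} [Field K] [CommRing Λ] [Algebra K Λ]
    (𝔫 : Ideal Λ) (hnil : IsNilpotent 𝔫) (hK : ∀ l : Λ, ∃ c : K, l - algebraMap K Λ c ∈ 𝔫)
    [AddCommGroup N] [Module K N] [Module Λ N] [IsScalarTower K Λ N] [Module.Finite K N]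
    [Ring Γ] [AddCommGroup N'] [Module Γ N'] (ε : Γ →+* Λ) (hε : Function.Surjective ε)
    (ι : N →+ N') (q : N' →+ N) (hι : Function.Injective ι) (hq : Function.Surjective q)
    (hex : ∀ x, q x = 0 → ∃ y, x = ι y)
    (hqΓ : ∀ g x, q (g • x) = ε g • q x) (hιΓ : ∀ (g : Γ) x, ι (ε g • x) = g • ι x)
    (hker : ∀ g, ε g = 0 → ∃ ν : Λ, ∀ x, g • x = ι (ν • q x))
    (a b : Γ) (ha : ε a ∈ 𝔫) (hb : ε b ∈ 𝔫) (c : Λ) (hc : c ∉ 𝔫)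
    (hab : ∀ x, (a * b - b * a) • x = ι (c • q x)) :
    (Module.finrank K N : K) = 0 := by
  classical
  obtain ⟨n, hn⟩ : ∃ n, Module.finrank K N = n := ⟨_, rfl⟩
  obtain ⟨e, he⟩ := exists_triangular_basis 𝔫 hnil hK n N hn
  rw [hn]
  -- lifts
  have hlift : ∀ k : K, ∃ g : Γ, ε g = algebraMap K Λ k ∧ (k = 0 → g = 0) := by
    intro k
    by_cases hk : k = 0
    · exact ⟨0, by simp [hk], fun _ => rfl⟩
    · obtain ⟨g, hg⟩ := hε (algebraMap K Λ k)
      exact ⟨g, hg, fun h => absurd h hk⟩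
  choose t ht ht0 using hlift
  choose e' he' using fun j => hq (e j)
  choose v hv using hker
  -- triangularity of all of Λ
  have htri : ∀ (ν : Λ) (i j : Fin n), i < j → e.repr (ν • e j) i = 0 := by
    intro ν i j hij
    obtain ⟨k, hk⟩ := hK ν
    have : ν • e j = (ν - algebraMap K Λ k) • e j + k • e j := by
      rw [sub_smul, algebraMap_smul]; abel
    rw [this, map_add, Finsupp.add_apply, he _ hk i j hij.le, map_smul]
    simp [Finsupp.single_apply, hij.ne']
  have hdec : ∀ g : Γ, ∀ j, ∃ w : N, g • e' j = ∑ i, t (e.repr (ε g • e j) i) • e' i + ι w := by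
    intro g j
    obtain ⟨w, hw⟩ := hex (g • e' j - ∑ i, t (e.repr (ε g • e j) i) • e' i) (by
      rw [map_sub, map_sum, hqΓ, he', sub_eq_zero]
      conv_lhs => rw [← e.sum_repr (ε g • e j)]
      refine Finset.sum_congr rfl fun i _ => ?_
      rw [hqΓ, ht, he', algebraMap_smul])
    exact ⟨w, by rw [← hw]; abel⟩
  choose u hu using hdec a
  choose w hw using hdec b
  let α : Fin n → Fin n → K := fun i j => e.repr (ε a • e j) i
  let β : Fin n → Fin n → K := fun i j => e.repr (ε b • e j) i
  have hα : ∀ i j, i ≤ j → α i j = 0 := fun i j hij => he _ ha i j hij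
  have hβ : ∀ i j, i ≤ j → β i j = 0 := fun i j hij => he _ hb i j hij
  have hae : ∀ j, ε a • e j = ∑ i, α i j • e i := fun j => (e.sum_repr _).symm
  have hbe : ∀ j, ε b • e j = ∑ i, β i j • e i := fun j => (e.sum_repr _).symm
  -- commutation past lifts
  have hcomm : ∀ (g : Γ) (k : K) (i : Fin n), ∃ ν : Λ, g • t k • e' i = t k • g • e' i + ι (ν • e i) ∧
      (k = 0 → ν = 0) := by
    intro g k i
    by_cases hk : k = 0
    · exact ⟨0, by simp [ht0 k hk], fun _ => rfl⟩
    · have h0 : ε (g * t k - t k * g) = 0 := by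
        rw [map_sub, map_mul, map_mul, mul_comm, sub_self]
      refine ⟨v _ h0, ?_, fun h => absurd h hk⟩
      rw [← he' i, ← hv _ h0 (e' i), sub_smul, mul_smul, mul_smul]; abel
  choose νa hνa hνa0 using hcomm a
  choose νb hνb hνb0 using hcomm b
  -- formula for products
  have hprod : ∀ (g : Γ) (wg : Fin n → N) (g2 : Γ) (wg2 : Fin n → N)
      (ν : K → Fin n → Λ)
      (_ : ∀ j, g • e' j = ∑ i, t (e.repr (ε g • e j) i) • e' i + ι (wg j))
      (_ : ∀ j, g2 • e' j = ∑ i, t (e.repr (ε g2 • e j) i) • e' i + ι (wg2 j))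
      (_ : ∀ k i, g • t k • e' i = t k • g • e' i + ι (ν k i • e i)) (j : Fin n),
      (g * g2) • e' j = ∑ k, (∑ i, t (e.repr (ε g2 • e j) i) * t (e.repr (ε g • e i) k)) • e' k
        + ι (∑ i, e.repr (ε g2 • e j) i • wg i + ∑ i, ν (e.repr (ε g2 • e j) i) i • e i + ε g • wg2 j) := by
    intro g wg g2 wg2 ν h1 h2 h3 j
    rw [mul_smul, h2 j, smul_add, Finset.smul_sum]
    simp_rw [h3, h1, smul_add, Finset.smul_sum]
    rw [map_add, map_add, map_sum, map_sum, hιΓ]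
    simp_rw [Finset.sum_add_distrib]
    have h4 : ∀ i, ι (e.repr (ε g2 • e j) i • wg i) = t (e.repr (ε g2 • e j) i) • ι (wg i) := by
      intro i
      rw [← hιΓ, ht, algebraMap_smul]
    simp_rw [h4, Finset.sum_smul, mul_smul]
    rw [Finset.sum_comm]
    abel
  have hP1 := hprod a u b w νa hu hw hνa
  have hP2 := hprod b w a u νb hw hu hνb
  -- key congruence
  have hkey : ∀ j, e.repr (c • e j) j =
      e.repr (∑ i, β i j • u i) j + e.repr (ε a • w j) j
      - e.repr (∑ i, α i j • w i) j - e.repr (ε b • u j) j := by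
    intro j
    let g : Fin n → Γ := fun k => ∑ i, t (β i j) * t (α k i) - ∑ i, t (α i j) * t (β k i)
    have hg0 : ∀ k, ε (g k) = 0 := by
      intro k
      have h1 : ε a • ε b • e j = ε b • ε a • e j := by
        rw [← mul_smul, ← mul_smul, mul_comm]
      rw [hbe j, hae j, Finset.smul_sum, Finset.smul_sum] at h1
      have h2 : ∀ (l : Λ) (k : K) (x : N), l • k • x = k • l • x := fun l k x => by
        rw [← algebraMap_smul Λ k x, ← algebraMap_smul Λ k (l • x), ← mul_smul, ← mul_smul, mul_comm]
      simp_rw [h2] at h1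
      have h3 := congrArg (fun z => e.repr z k) h1
      simp only [map_sum, map_smul, Finsupp.coe_finsetSum, Finset.sum_apply, Finsupp.smul_apply, smul_eq_mul] at h3
      simp only [g, map_sub, map_sum, map_mul, ht]
      simp only [← map_mul, ← map_sum, ← map_sub]
      change ∑ i, β i j * α k i = ∑ i, α i j * β k i at h3
      rw [h3, sub_self, map_zero]
    have hgle : ∀ k, k ≤ j → g k = 0 := by
      intro k hk
      have : ∀ i, (i ≤ j ∨ k ≤ i) := fun i => by
        rcases le_total i j with h | h
        · exact Or.inl h
        · exact Or.inr (hk.trans h)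
      simp only [g]
      rw [Finset.sum_eq_zero, Finset.sum_eq_zero, sub_zero]
      · intro i _
        rcases this i with h | h
        · rw [ht0 _ (hα i j h), zero_mul]
        · rw [ht0 _ (hβ k i h), mul_zero]
      · intro i _
        rcases this i with h | h
        · rw [ht0 _ (hβ i j h), zero_mul]
        · rw [ht0 _ (hα k i h), mul_zero]
    have hgk : ∀ k, ∃ ν : Λ, g k • e' k = ι (ν • e k) ∧ (k ≤ j → ν = 0) := by
      intro k
      by_cases hk : k ≤ j
      · exact ⟨0, by simp [hgle k hk], fun _ => rfl⟩
      · exact ⟨v _ (hg0 k), by rw [hv _ (hg0 k), he'], fun h => absurd h hk⟩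
    choose νg hνg hνg0 using hgk
    have h5 := hab (e' j)
    rw [sub_smul, hP1 j, hP2 j, he'] at h5
    have h6 : ∑ k, (∑ i, t (β i j) * t (α k i)) • e' k - ∑ k, (∑ i, t (α i j) * t (β k i)) • e' k
        = ι (∑ k, νg k • e k) := by
      rw [← Finset.sum_sub_distrib, map_sum]
      refine Finset.sum_congr rfl fun k _ => ?_
      rw [← hνg k, ← sub_smul]
    have h7 : c • e j = ∑ k, νg k • e k +
        ((∑ i, β i j • u i + ∑ i, νa (β i j) i • e i + ε a • w j) -
        (∑ i, α i j • w i + ∑ i, νb (α i j) i • e i + ε b • u j)) := by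
      apply hι
      rw [map_add ι, map_sub ι, ← h6, ← h5]
      simp only [α, β]
      abel
    have hz1 : e.repr (∑ k, νg k • e k) j = 0 := by
      rw [map_sum, Finsupp.coe_finsetSum, Finset.sum_apply]
      refine Finset.sum_eq_zero fun k _ => ?_
      by_cases hk : k ≤ j
      · rw [hνg0 k hk]; simp
      · exact htri _ _ _ (not_le.mp hk)
    have hz2 : e.repr (∑ i, νa (β i j) i • e i) j = 0 := by
      rw [map_sum, Finsupp.coe_finsetSum, Finset.sum_apply]
      refine Finset.sum_eq_zero fun k _ => ?_
      by_cases hk : k ≤ j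
      · rw [hνa0 _ k (hβ k j hk)]; simp
      · exact htri _ _ _ (not_le.mp hk)
    have hz3 : e.repr (∑ i, νb (α i j) i • e i) j = 0 := by
      rw [map_sum, Finsupp.coe_finsetSum, Finset.sum_apply]
      refine Finset.sum_eq_zero fun k _ => ?_
      by_cases hk : k ≤ j
      · rw [hνb0 _ k (hα k j hk)]; simp
      · exact htri _ _ _ (not_le.mp hk)
    rw [h7]
    simp only [map_add, map_sub, Finsupp.add_apply, Finsupp.sub_apply, hz1, hz2, hz3]
    ring
  -- linear maps
  let La : N →ₗ[K] N := Algebra.lsmul K K N (ε a)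
  let Lb : N →ₗ[K] N := Algebra.lsmul K K N (ε b)
  let U : N →ₗ[K] N := e.constr K u
  let W : N →ₗ[K] N := e.constr K w
  have htr : ∀ f : N →ₗ[K] N, LinearMap.trace K N f = ∑ j, e.repr (f (e j)) j := by
    intro f
    rw [LinearMap.trace_eq_matrix_trace K e, Matrix.trace]
    simp [LinearMap.toMatrix_apply]
  have hsum : ∑ j, e.repr (c • e j) j = 0 := by
    simp_rw [hkey]
    have h1 : ∑ j, e.repr (∑ i, β i j • u i) j = LinearMap.trace K N (U * Lb) := by
      rw [htr]
      refine Finset.sum_congr rfl fun j _ => ?_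
      congr 2
      change _ = U (ε b • e j)
      rw [hbe j, map_sum]
      simp [U]
    have h2 : ∑ j, e.repr (∑ i, α i j • w i) j = LinearMap.trace K N (W * La) := by
      rw [htr]
      refine Finset.sum_congr rfl fun j _ => ?_
      congr 2
      change _ = W (ε a • e j)
      rw [hae j, map_sum]
      simp [W]
    have h3 : ∑ j, e.repr (ε a • w j) j = LinearMap.trace K N (La * W) := by
      rw [htr]
      refine Finset.sum_congr rfl fun j _ => ?_
      congr 2
      change _ = ε a • W (e j)
      simp [W]
    have h4 : ∑ j, e.repr (ε b • u j) j = LinearMap.trace K N (Lb * U) := by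
      rw [htr]
      refine Finset.sum_congr rfl fun j _ => ?_
      congr 2
      change _ = ε b • U (e j)
      simp [U]
    rw [Finset.sum_sub_distrib, Finset.sum_sub_distrib, Finset.sum_add_distrib, h1, h2, h3, h4,
      LinearMap.trace_mul_comm K U Lb, LinearMap.trace_mul_comm K W La]
    ring
  obtain ⟨k, hk⟩ := hK c
  have hk0 : k ≠ 0 := by
    rintro rfl
    apply hc
    simpa using hk
  have hdiag : ∀ j, e.repr (c • e j) j = k := by
    intro j
    have : c • e j = (c - algebraMap K Λ k) • e j + k • e j := by
      rw [sub_smul, algebraMap_smul]; abel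
    rw [this, map_add, Finsupp.add_apply, he _ hk j j le_rfl, map_smul]
    simp
  simp_rw [hdiag] at hsum
  simp only [Finset.sum_const, Finset.card_univ, Fintype.card_fin, nsmul_eq_mul] at hsum
  exact (mul_eq_zero.mp hsum).resolve_right hk0

open IsLocalRing in
theorem length_simple {R 𝓑 B W : Type*} [CommRing R] [IsLocalRing R] [Ring 𝓑] [Algebra R 𝓑]
    [Ring B] [Algebra (ResidueField R) B] (ψ : 𝓑 →+* B) (hψ : Function.Surjective ψ)
    (hψR : ∀ r, ψ (algebraMap R 𝓑 r) = algebraMap (ResidueField R) B (residue R r))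
    (hker : ∀ x, ψ x = 0 → x ∈ (maximalIdeal R • (⊤ : Submodule R 𝓑)))
    (e : 𝓑) (s d : ℕ)
    [AddCommGroup W] [Module 𝓑 W] [Module R W] [IsScalarTower R 𝓑 W]
    (hall : ∀ [Module (ResidueField R) W] [Module B W]
        [IsScalarTower (ResidueField R) B W]
        [Module.Finite (ResidueField R) W], ∃ x : ℕ, Module.finrank (ResidueField R) W = s * (d * x) ∧
          Module.finrank (ResidueField R) (LinearMap.range
            (Algebra.lsmul (ResidueField R) (ResidueField R) W (ψ e))) = d * x)
    (hm : ∀ r ∈ maximalIdeal R, ∀ w : W, r • w = 0)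
    (hlen : Module.length R W ≠ ⊤) :
    ∃ x : ℕ, Module.length R W = (s * (d * x) : ℕ) ∧
      Module.length R (LinearMap.range (Algebra.lsmul R R W e)) = (d * x : ℕ) := by
  have hk : ∀ x, x ∈ (maximalIdeal R • (⊤ : Submodule R 𝓑)) → ∀ w : W, x • w = 0 := by
    intro x hx w
    refine Submodule.smul_induction_on hx ?_ ?_
    · intro r hr b _
      rw [smul_assoc, hm r hr]
    · intro x y hx hy; rw [add_smul, hx, hy, add_zero]
  have hk2 : ∀ x y, ψ x = ψ y → ∀ w : W, x • w = y • w := by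
    intro x y h w
    rw [← sub_eq_zero, ← sub_smul]
    exact hk _ (hker _ (by rw [map_sub, h, sub_self])) w
  let sB : SMul B W := ⟨fun b w => Function.surjInv hψ b • w⟩
  have hsB : ∀ (x : 𝓑) (w : W), ψ x • w = x • w := fun x w =>
    hk2 _ _ (Function.surjInv_eq hψ _) w
  let mB : Module B W := Function.Surjective.moduleLeft ψ hψ hsB
  let mK : Module (ResidueField R) W := Module.compHom W (algebraMap (ResidueField R) B)
  have hKB : ∀ (k : ResidueField R) (w : W), k • w = algebraMap (ResidueField R) B k • w :=
    fun k w => rfl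
  have tK : IsScalarTower (ResidueField R) B W := ⟨fun k b w => by
    rw [hKB, Algebra.smul_def, mul_smul]⟩
  have hRK : ∀ (r : R) (w : W), residue R r • w = r • w := by
    intro r w
    rw [hKB, ← hψR, hsB, algebraMap_smul]
  have tR : IsScalarTower R (ResidueField R) W := ⟨fun r k w => by
    obtain ⟨k, rfl⟩ := residue_surjective k
    have : r • residue R k = residue R (r * k) := by
      rw [map_mul, Algebra.smul_def]; rfl
    rw [this, hRK, hRK, mul_smul]⟩
  have hl : ∀ (V : Type _) [AddCommGroup V] [Module R V] [Module (ResidueField R) V]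
     [IsScalarTower R (ResidueField R) V], Module.length R V = Module.length (ResidueField R) V :=
    fun V _ _ _ _ => Module.length_eq_of_surjective residue_surjective
  have fin : Module.Finite (ResidueField R) W := by
    rw [hl W, Module.length_ne_top_iff, isFiniteLength_iff_isNoetherian_isArtinian] at hlen
    have := hlen.1
    infer_instance
  obtain ⟨x, h1, h2⟩ := hall
  refine ⟨x, ?_, ?_⟩
  · rw [hl W, Module.length_eq_finrank, h1]
  · rw [← h2, ← Module.length_eq_finrank, ← hl]
    refine LinearEquiv.length_eq (R := R) ?_
    refine LinearEquiv.ofEq _ (Submodule.restrictScalars R (LinearMap.range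
            (Algebra.lsmul (ResidueField R) (ResidueField R) W (ψ e)))) ?_
    ext y
    simp [hsB]

open IsLocalRing in
theorem length_idem {R 𝓑 B : Type*} {W : Type uu} [CommRing R] [IsLocalRing R] [Ring 𝓑] [Algebra R 𝓑]
    [Ring B] [Algebra (ResidueField R) B] (ψ : 𝓑 →+* B) (hψ : Function.Surjective ψ)
    (hψR : ∀ r, ψ (algebraMap R 𝓑 r) = algebraMap (ResidueField R) B (residue R r))
    (hker : ∀ x, ψ x = 0 → x ∈ (maximalIdeal R • (⊤ : Submodule R 𝓑)))
    (e : 𝓑) (s d : ℕ)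
    [AddCommGroup W] [Module 𝓑 W]
    (hall : ∀ (W : Type uu) [AddCommGroup W] [Module (ResidueField R) W] [Module B W]
        [IsScalarTower (ResidueField R) B W]
        [Module.Finite (ResidueField R) W], ∃ x : ℕ, Module.finrank (ResidueField R) W = s * (d * x) ∧
          Module.finrank (ResidueField R) (LinearMap.range
            (Algebra.lsmul (ResidueField R) (ResidueField R) W (ψ e))) = d * x)
    (hfin : IsFiniteLength 𝓑 W) :
    ∀ [Module R W] [IsScalarTower R 𝓑 W] (_he : ∀ w : W, e • e • w = e • w)
    (_hm : ∀ r ∈ maximalIdeal R, ∃ N : ℕ, ∀ w : W, r ^ N • w = 0)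
    (_hlen : Module.length R W ≠ ⊤),
    ∃ x : ℕ, Module.length R W = (s * (d * x) : ℕ) ∧
      Module.length R (LinearMap.range (Algebra.lsmul R R W e)) = (d * x : ℕ) := by
  induction hfin with
  | @of_subsingleton W _ _ hs =>
    intro _ _ he hm hlen
    refine ⟨0, ?_, ?_⟩
    · simp
    · simp
  | @of_simple_quotient W _ _ V hsim hV ih =>
    intro _ _ he hm hlen
    have hex := Module.length_eq_add_of_exact (R := R) (V.subtype.restrictScalars R)
      (V.mkQ.restrictScalars R) V.injective_subtype V.mkQ_surjective
      (by intro x; simp)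
    have heV : ∀ w : V, e • e • w = e • w := fun w => Subtype.ext (he w)
    have heQ : ∀ w : W ⧸ V, e • e • w = e • w := by
      intro w
      obtain ⟨w, rfl⟩ := V.mkQ_surjective w
      rw [← map_smul, ← map_smul, he]
    have hlV : Module.length R V ≠ ⊤ := by
      intro h; apply hlen; rw [hex]; erw [h]; simp
    have hlQ : Module.length R (W ⧸ V) ≠ ⊤ := by
      intro h; apply hlen; rw [hex]; erw [h]; simp
    obtain ⟨x, hx1, hx2⟩ := ih heV (fun r hr => by
      obtain ⟨N, hN⟩ := hm r hr
      exact ⟨N, fun w => Subtype.ext (hN w)⟩) hlV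
    have hmQ : ∀ r ∈ maximalIdeal R, ∀ w : W ⧸ V, r • w = 0 := by
      intro r hr
      obtain ⟨N, hN⟩ := hm r hr
      let f : (W ⧸ V) →ₗ[𝓑] (W ⧸ V) :=
        { toFun := fun w => r • w
          map_add' := fun a b => smul_add _ _ _
          map_smul' := fun b w => (smul_algebra_smul_comm r b w).symm }
      have hf : ∀ k w, (f ^ k) w = r ^ k • w := by
        intro k
        induction k with
        | zero => simp
        | succ k ih => intro w; rw [pow_succ', Module.End.mul_apply, ih, pow_succ', mul_smul]; rfl
      have hfN : f ^ N = 0 := by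
        ext w
        simp only [LinearMap.comp_apply, hf]
        rw [← LinearMap.restrictScalars_apply R, ← map_smul, hN]
        simp
      rcases LinearMap.bijective_or_eq_zero f with h | h
      · exfalso
        have : Function.Bijective (f ^ N) := by
          rw [Module.End.coe_pow]; exact h.iterate N
        rw [hfN] at this
        have hnt := IsSimpleModule.nontrivial 𝓑 (W ⧸ V)
        obtain ⟨a, b, hab⟩ := hnt
        exact hab (this.1 rfl)
      · intro w
        exact LinearMap.congr_fun h w
    obtain ⟨y, hy1, hy2⟩ := length_simple (W := W ⧸ V) ψ hψ hψR hker e s d (hall (W ⧸ V)) hmQ hlQ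
    refine ⟨x + y, ?_, ?_⟩
    · rw [hex]
      erw [hx1, hy1]
      rw [← Nat.cast_add]
      congr 1; ring
    · let i : LinearMap.range (Algebra.lsmul R R V e) →ₗ[R] LinearMap.range (Algebra.lsmul R R W e) :=
        (V.subtype.restrictScalars R).restrict (by rintro _ ⟨v, rfl⟩; exact ⟨v, rfl⟩)
      let j : LinearMap.range (Algebra.lsmul R R W e) →ₗ[R]
          LinearMap.range (Algebra.lsmul R R (W ⧸ V) e) :=
        (V.mkQ.restrictScalars R).restrict (by rintro _ ⟨v, rfl⟩; exact ⟨V.mkQ v, rfl⟩)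
      have := Module.length_eq_add_of_exact (R := R) i j ?_ ?_ ?_
      · rw [this, hx2, hy2, ← Nat.cast_add]
        congr 1; ring
      · intro a b hab
        have := congrArg Subtype.val hab
        exact Subtype.ext (Subtype.ext this)
      · rintro ⟨_, w, rfl⟩
        obtain ⟨w, rfl⟩ := V.mkQ_surjective w
        exact ⟨⟨e • w, w, rfl⟩, rfl⟩
      · rintro ⟨_, w, rfl⟩
        constructor
        · intro h
          have h2 : V.mkQ (e • w) = 0 := congrArg Subtype.val h
          have h3 : e • w ∈ V := (Submodule.Quotient.mk_eq_zero V).1 h2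
          refine ⟨⟨e • ⟨e • w, h3⟩, ⟨e • w, h3⟩, rfl⟩, Subtype.ext (he w)⟩
        · rintro ⟨⟨v, hv⟩, h⟩
          rw [← h]
          apply Subtype.ext
          exact (Submodule.Quotient.mk_eq_zero V).2 v.2

theorem matrix_idem {κ B : Type*} [Field κ] [Ring B] [Algebra κ B] [Module.Finite κ B]
    [IsSimpleRing B] :
    ∃ (e : B) (s d : ℕ), e * e = e ∧ s ^ 2 * d = Module.finrank κ B ∧
      (d = 1 → ∀ β : B, ∃ r : κ, e * β * e = r • e) ∧
      ∀ (W : Type _) [AddCommGroup W] [Module κ W] [Module B W] [IsScalarTower κ B W]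
        [Module.Finite κ W], ∃ x : ℕ, Module.finrank κ W = s * (d * x) ∧
          Module.finrank κ (LinearMap.range (Algebra.lsmul κ κ W e)) = d * x := by
  have := IsArtinianRing.of_finite κ B
  obtain ⟨s, hs, D, _, _, _, ⟨φ⟩⟩ := IsSimpleRing.exists_algEquiv_matrix_divisionRing_finite κ B
  let E : Fin s → Fin s → B := fun i j => φ.symm (Matrix.single i j 1)
  have hE : ∀ i j k l, E i j * E k l = if j = k then E i l else 0 := by
    intro i j k l
    simp only [E, ← map_mul]
    split_ifs with h
    · subst h; rw [Matrix.single_mul_single_same]; simp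
    · rw [Matrix.single_mul_single_of_ne _ _ _ _ h]; simp
  have hsum : ∑ i, E i i = 1 := by
    simp only [E, ← map_sum]
    rw [Matrix.sum_single_one, map_one]
  refine ⟨E 0 0, s, Module.finrank κ D, by simp [hE], ?_, ?_, ?_⟩
  · rw [φ.toLinearEquiv.finrank_eq, Module.finrank_matrix]
    simp [sq]
  · intro hd β
    obtain ⟨r, hr⟩ := (finrank_eq_one_iff_of_nonzero' (1:D) one_ne_zero).1 hd (φ β 0 0)
    refine ⟨r, φ.injective ?_⟩
    simp only [E, map_mul, map_smul, AlgEquiv.apply_symm_apply]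
    rw [Matrix.single_mul_mul_single, ← hr, Matrix.smul_single]
    simp
  · intro W _ _ _ _ _
    let V := LinearMap.range (Algebra.lsmul κ κ W (E 0 0))
    have hV : ∀ v : V, E 0 0 • (v : W) = v := by
      rintro ⟨_, w, rfl⟩
      simp only [Algebra.lsmul_coe]
      rw [smul_smul, hE]; simp
    let f : W ≃ₗ[κ] (Fin s → V) :=
      { toFun := fun w i => ⟨E 0 i • w, E 0 i • w, by
          simp only [Algebra.lsmul_coe]; rw [smul_smul, hE]; simp⟩
        map_add' := by intro a b; ext i; simp
        map_smul' := by intro a b; ext i; exact smul_algebra_smul_comm a (E 0 i) b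
        invFun := fun v => ∑ i, E i 0 • (v i : W)
        left_inv := by
          intro w
          simp only [smul_smul, hE]
          simp [← Finset.sum_smul, hsum]
        right_inv := by
          intro v
          ext i
          simp only [Finset.smul_sum, smul_smul, hE]
          simp [ite_smul, hV] }
    let c : D →+* B := φ.symm.toRingEquiv.toRingHom.comp (Matrix.scalar (Fin s))
    have hc : ∀ d i j, c d * E i j = E i j * c d := by
      intro d i j
      simp only [c, E, RingHom.comp_apply]
      change φ.symm _ * _ = _ * φ.symm _
      rw [← map_mul, ← map_mul]
      congr 1
      ext a b
      simp [Matrix.scalar_apply, Matrix.diagonal_mul, Matrix.mul_diagonal, Matrix.single_apply]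
    have hcκ : ∀ k : κ, c (algebraMap κ D k) = algebraMap κ B k := by
      intro k
      rw [← φ.symm.commutes k]
      simp only [c, RingHom.comp_apply]
      change φ.symm _ = _
      congr 1
    let _ : Module D V :=
      { smul := fun d v => ⟨c d • (v:W), c d • (v:W), by
          simp only [Algebra.lsmul_coe]; rw [smul_smul, ← hc, ← smul_smul, hV]⟩
        one_smul := fun v => Subtype.ext (by change c 1 • (v:W) = v; simp)
        mul_smul := fun a b v => Subtype.ext (by
          change c (a*b) • (v:W) = c a • c b • (v:W); simp [mul_smul])
        smul_zero := fun a => Subtype.ext (by change c a • (0:W) = 0; simp)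
        smul_add := fun a v w => Subtype.ext (by
          change c a • ((v:W) + w) = c a • (v:W) + c a • (w:W); simp)
        add_smul := fun a b v => Subtype.ext (by
          change c (a+b) • (v:W) = c a • (v:W) + c b • (v:W); simp [add_smul])
        zero_smul := fun v => Subtype.ext (by change c 0 • (v:W) = 0; simp) }
    have : IsScalarTower κ D V := by
      refine ⟨fun k d v => Subtype.ext ?_⟩
      change c (k • d) • (v:W) = k • (c d • (v:W))
      rw [Algebra.smul_def, map_mul, hcκ, mul_smul, algebraMap_smul]
    refine ⟨Module.finrank D V, ?_, ?_⟩
    · rw [Module.finrank_mul_finrank, f.finrank_eq, Module.finrank_pi_fintype]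
      simp
    · rw [Module.finrank_mul_finrank]

theorem num_aux {p n b s d x : ℕ} (hp : p.Prime) (hb : ¬ p ∣ b) (h1 : s ^ 2 * d = (p ^ n) ^ 2)
    (h2 : b * p ^ n = s * (d * x)) : d = 1 ∧ x = b := by
  obtain ⟨u, hu, rfl⟩ := (Nat.dvd_prime_pow hp).1 (show s ∣ p ^ (n * 2) by
    rw [pow_mul, ← h1, sq, mul_assoc]; exact dvd_mul_right _ _)
  obtain ⟨v, hv, rfl⟩ := (Nat.dvd_prime_pow hp).1 (show d ∣ p ^ (n * 2) by
    rw [pow_mul, ← h1]; exact dvd_mul_left _ _)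
  have h3 : u * 2 + v = n * 2 := by
    rw [← pow_mul, ← pow_mul, ← pow_add] at h1
    exact Nat.pow_right_injective hp.two_le h1
  have h4 : u + v ≤ n := by
    by_contra hlt
    push Not at hlt
    apply hb
    obtain ⟨t, ht⟩ := Nat.exists_eq_add_of_lt hlt
    have : b * p ^ n = p * (p ^ t * x) * p ^ n := by
      rw [h2, ← mul_assoc, ← pow_add, ht]; ring
    exact ⟨_, Nat.eq_of_mul_eq_mul_right (pow_pos hp.pos n) this⟩
  have hv0 : v = 0 := by omega
  have hun : u = n := by omega
  subst hv0 hun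
  refine ⟨by simp, ?_⟩
  have : x * p ^ u = b * p ^ u := by rw [h2]; ring
  exact Nat.eq_of_mul_eq_mul_right (pow_pos hp.pos u) this

theorem smul_top_mul {R 𝓑 : Type*} [CommRing R] [Ring 𝓑] [Algebra R 𝓑] (I J : Ideal R) {x y : 𝓑}
    (hx : x ∈ I • (⊤ : Submodule R 𝓑)) (hy : y ∈ J • (⊤ : Submodule R 𝓑)) :
    x * y ∈ (I * J) • (⊤ : Submodule R 𝓑) := by
  refine Submodule.smul_induction_on hx ?_ ?_
  · intro r hr b _
    refine Submodule.smul_induction_on hy ?_ ?_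
    · intro t ht c _
      rw [smul_mul_smul_comm]
      exact Submodule.smul_mem_smul (Ideal.mul_mem_mul hr ht) trivial
    · intro x y hx hy; rw [mul_add]; exact add_mem hx hy
  · intro x y hx hy; rw [add_mul]; exact add_mem hx hy

theorem smul_top_mul_right {R 𝓑 : Type*} [CommRing R] [Ring 𝓑] [Algebra R 𝓑] (I : Ideal R)
    {x : 𝓑} (y : 𝓑)
    (hx : x ∈ I • (⊤ : Submodule R 𝓑)) : x * y ∈ I • (⊤ : Submodule R 𝓑) := by
  have := smul_top_mul I ⊤ (y := y) hx (by simp)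
  simpa using this

open IsLocalRing in
theorem exists_good_idem {R 𝓑 B : Type*} {W : Type uu} [CommRing R] [IsLocalRing R]
    [Ring 𝓑] [Algebra R 𝓑]
    [Ring B] [Algebra (ResidueField R) B] [Module.Finite (ResidueField R) B] [IsSimpleRing B]
    (ψ : 𝓑 →+* B) (hψ : Function.Surjective ψ)
    (hψR : ∀ r, ψ (algebraMap R 𝓑 r) = algebraMap (ResidueField R) B (residue R r))
    (hker : ∀ x, ψ x = 0 ↔ x ∈ (maximalIdeal R • (⊤ : Submodule R 𝓑)))
    {p n b : ℕ} (hp : p.Prime) (hb : ¬ p ∣ b)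
    (hrank : Module.finrank (ResidueField R) B = (p ^ n) ^ 2)
    [AddCommGroup W] [Module 𝓑 W] [Module R W] [IsScalarTower R 𝓑 W]
    (N : ℕ) (hN : ∀ r ∈ maximalIdeal R ^ N, ∀ w : W, r • w = 0)
    (hlen : Module.length R W = (b * p ^ n : ℕ)) :
    ∃ e : 𝓑, (∀ w : W, e • e • w = e • w) ∧
      (∀ β : 𝓑, ∃ r : R, ∀ w : W, e • β • e • w = r • e • w) ∧
      Module.length R (LinearMap.range (Algebra.lsmul R R W e)) = (b : ℕ) := by
  obtain ⟨ebar, s, d, he, hsd, hd, hall⟩ := matrix_idem.{_, _, uu} (κ := ResidueField R) (B := B)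
  have hNtop : ∀ x ∈ (maximalIdeal R ^ N • (⊤ : Submodule R 𝓑)), ∀ w : W, x • w = 0 := by
    intro x hx w
    refine Submodule.smul_induction_on hx ?_ ?_
    · intro r hr b _
      rw [smul_assoc, hN r hr]
    · intro x y hx hy; rw [add_smul, hx, hy, add_zero]
  have hlift : ∀ k : ℕ, ∃ e : 𝓑, ψ e = ebar ∧
      e * e - e ∈ (maximalIdeal R ^ (k + 1) • (⊤ : Submodule R 𝓑)) := by
    intro k
    induction k with
    | zero =>
      obtain ⟨e, rfl⟩ := hψ ebar
      refine ⟨e, rfl, ?_⟩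
      rw [zero_add, pow_one, ← hker, map_sub, map_mul, he, sub_self]
    | succ k ih =>
      obtain ⟨e, h1, h2⟩ := ih
      refine ⟨3 * e * e - 2 * e * e * e, ?_, ?_⟩
      · simp only [map_sub, map_mul, h1, map_ofNat]
        rw [mul_assoc, he, mul_assoc, he, mul_assoc, he, ← sub_mul]
        norm_num
      · have : (3 * e * e - 2 * e * e * e) * (3 * e * e - 2 * e * e * e)
          - (3 * e * e - 2 * e * e * e) = ((e * e - e) * (e * e - e)) * (4 * e * e - 4 * e - 3) := by
          noncomm_ring
        rw [this]
        refine smul_top_mul_right _ _ ?_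
        refine Submodule.smul_mono_left ?_ (smul_top_mul _ _ h2 h2)
        rw [← pow_add]
        exact Ideal.pow_le_pow_right (by omega)
  obtain ⟨e, hee, h2⟩ := hlift N
  have hid : ∀ w : W, e • e • w = e • w := by
    intro w
    have := hNtop _ (Submodule.smul_mono_left (Ideal.pow_le_pow_right (Nat.le_succ N)) h2) w
    rw [sub_smul, sub_eq_zero, mul_smul] at this
    exact this
  subst hee
  have hlt : Module.length R W ≠ ⊤ := by rw [hlen]; exact ENat.natCast_ne_top _
  have hflR := Module.length_ne_top_iff.1 hlt
  have hfl : IsFiniteLength 𝓑 W := by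
    rw [isFiniteLength_iff_isNoetherian_isArtinian] at hflR ⊢
    obtain ⟨_, _⟩ := hflR
    exact ⟨isNoetherian_of_tower R inferInstance, isArtinian_of_tower R inferInstance⟩
  obtain ⟨x, hx1, hx2⟩ := length_idem ψ hψ hψR (fun x => (hker x).1) e s d hall hfl hid
    (fun r hr => ⟨N, fun w => hN _ (Ideal.pow_mem_pow hr N) w⟩) hlt
  rw [hlen] at hx1
  obtain ⟨rfl, rfl⟩ := num_aux hp hb (hsd.trans hrank) (by exact_mod_cast hx1)
  refine ⟨e, hid, ?_, by simpa using hx2⟩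
  have h1 : ∀ β : 𝓑, ∃ r : R, e * β * e - r • e ∈ (maximalIdeal R • (⊤ : Submodule R 𝓑)) := by
    intro β
    obtain ⟨r, hr⟩ := hd rfl (ψ β)
    obtain ⟨r, rfl⟩ := residue_surjective r
    refine ⟨r, ?_⟩
    rw [← hker, map_sub, map_mul, map_mul, hr, Algebra.smul_def, Algebra.smul_def, map_mul, hψR,
      sub_self]
  have hP : ∀ k : ℕ, ∀ β : 𝓑, ∃ r : R, ∃ δ ∈ (maximalIdeal R ^ k • (⊤ : Submodule R 𝓑)),
      ∀ w : W, e • β • e • w = r • e • w + δ • w := by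
    intro k
    induction k with
    | zero => 
      intro β
      refine ⟨0, e * β * e, by simp, fun w => by simp [mul_smul]⟩
    | succ k ih =>
      have hδ : ∀ δ ∈ (maximalIdeal R • (⊤ : Submodule R 𝓑)), ∃ r : R,
          ∃ δ' ∈ (maximalIdeal R ^ (k + 1) • (⊤ : Submodule R 𝓑)),
          ∀ w : W, e • δ • e • w = r • e • w + δ' • w := by
        intro δ hδ
        refine Submodule.smul_induction_on hδ ?_ ?_
        · intro t ht β _
          obtain ⟨r, δ', h1, h2⟩ := ih β
          refine ⟨t * r, t • δ', ?_, ?_⟩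
          · rw [pow_succ', Submodule.mul_smul]
            exact Submodule.smul_mem_smul ht h1
          · intro w
            rw [smul_assoc, smul_algebra_smul_comm, h2, smul_add, mul_smul, smul_assoc]
        · rintro x y ⟨r, δ, h1, h2⟩ ⟨r', δ', h1', h2'⟩
          refine ⟨r + r', δ + δ', add_mem h1 h1', fun w => ?_⟩
          rw [add_smul, smul_add, h2, h2', add_smul, add_smul]; abel
      intro β
      obtain ⟨r, hr⟩ := h1 β
      obtain ⟨r', δ', h3, h4⟩ := hδ _ hr
      refine ⟨r + r', δ', h3, fun w => ?_⟩
      have h5 := h4 w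
      rw [sub_smul, smul_sub, mul_smul, mul_smul, hid, hid, smul_assoc, smul_algebra_smul_comm, hid,
        hid, sub_eq_iff_eq_add] at h5
      rw [h5, add_smul]; abel
  intro β
  obtain ⟨r, δ, h3, h4⟩ := hP N β
  exact ⟨r, fun w => by rw [h4, hNtop δ h3, add_zero]⟩

theorem length_eq_coeff {K Λ : Type*} {N : Type uu} [Field K] [CommRing Λ] [Algebra K Λ] (𝔫 : Ideal Λ)
    (hnil : IsNilpotent 𝔫) (hK : ∀ l : Λ, ∃ c : K, l - algebraMap K Λ c ∈ 𝔫)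
    [AddCommGroup N] [Module Λ N] (hfl : IsFiniteLength Λ N) :
    ∀ [Module K N] [IsScalarTower K Λ N], Module.length K N = Module.length Λ N := by
  induction hfl with
  | @of_subsingleton W _ _ hs =>
    intro _ _
    rw [Module.length_eq_zero, Module.length_eq_zero]
  | @of_simple_quotient W _ _ V hsim hV ih =>
    intro _ _
    have h1 := Module.length_eq_add_of_exact (R := Λ) V.subtype V.mkQ
      V.injective_subtype V.mkQ_surjective (by intro x; simp)
    have h2 := Module.length_eq_add_of_exact (R := K) (V.subtype.restrictScalars K)
      (V.mkQ.restrictScalars K) V.injective_subtype V.mkQ_surjective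
      (by intro x; simp)
    have h3 : Module.length K (W ⧸ V) = Module.length Λ (W ⧸ V) := by
      have hz : ∀ l ∈ 𝔫, ∀ x : W ⧸ V, l • x = 0 := by
        intro l hl
        obtain ⟨k, hk⟩ := hnil
        have hlk : l ^ k = 0 := by
          have := Ideal.pow_mem_pow hl k
          rw [hk] at this
          simpa using this
        rcases LinearMap.bijective_or_eq_zero (LinearMap.lsmul Λ (W ⧸ V) l) with h | h
        · exfalso
          have h4 : Function.Bijective ((LinearMap.lsmul Λ (W ⧸ V) l) ^ k) := by
            rw [Module.End.coe_pow]; exact h.iterate k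
          have h5 : (LinearMap.lsmul Λ (W ⧸ V) l) ^ k = 0 := by
            change (Algebra.lsmul Λ Λ (W ⧸ V) l) ^ k = 0
            rw [← map_pow, hlk, map_zero]
          rw [h5] at h4
          obtain ⟨a, b, hab⟩ := IsSimpleModule.nontrivial Λ (W ⧸ V)
          exact hab (h4.1 rfl)
        · intro x
          exact LinearMap.congr_fun h x
      have : IsSimpleModule K (W ⧸ V) := by
        rw [isSimpleModule_iff_toSpanSingleton_surjective] at hsim ⊢
        refine ⟨hsim.1, fun x hx y => ?_⟩
        obtain ⟨l, hl⟩ := hsim.2 x hx y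
        obtain ⟨c, hc⟩ := hK l
        refine ⟨c, ?_⟩
        have := hz _ hc x
        rw [sub_smul, algebraMap_smul, sub_eq_zero] at this
        rw [← hl]
        exact this.symm
      rw [Module.length_eq_one, Module.length_eq_one]
    rw [h1, h2]
    erw [ih, h3]

open IsLocalRing in
theorem abs_contra {R 𝓑 L L' G : Type*} [CommRing R] [IsLocalRing R]
    [Ring 𝓑] [Algebra R 𝓑] [AddCommGroup L] [Module 𝓑 L] [Module R L] [IsScalarTower R 𝓑 L]
    {p b : ℕ} (hp : p.Prime) (hpR : (p : R) = 0) (N : ℕ) (hN0 : N ≠ 0)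
    (hN : ∀ r ∈ maximalIdeal R ^ N, ∀ w : L, r • w = 0)
    (e : 𝓑) (hid : ∀ w : L, e • e • w = e • w)
    (heβ : ∀ β : 𝓑, ∃ r : R, ∀ w : L, e • β • e • w = r • e • w)
    (hlen : Module.length R (LinearMap.range (Algebra.lsmul R R L e)) = (b : ℕ))
    [Ring G] [AddCommGroup L'] [Module G L'] (ρ : G →+* 𝓑) (hρ : Function.Surjective ρ)
    (ι : L →+ L') (q : L' →+ L) (hι : Function.Injective ι) (hq : Function.Surjective q)
    (hex : ∀ x, q x = 0 → ∃ y, x = ι y)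
    (hqG : ∀ (g : G) x, q (g • x) = ρ g • q x) (hιG : ∀ (g : G) y, ι (ρ g • y) = g • ι y)
    (hkerG : ∀ g : G, ρ g = 0 → ∃ β : 𝓑, ∀ x, g • x = ι (β • q x))
    (g₁ g₂ : G) (r₁ r₂ : R) (hr₁ : r₁ ∈ maximalIdeal R) (hr₂ : r₂ ∈ maximalIdeal R)
    (hg₁ : ρ g₁ = algebraMap R 𝓑 r₁) (hg₂ : ρ g₂ = algebraMap R 𝓑 r₂)
    (c : R) (hc : c ∉ maximalIdeal R) (hcomm : ∀ x, (g₁ * g₂ - g₂ * g₁) • x = ι (c • q x)) :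
    p ∣ b := by
  -- the idempotent on L'
  obtain ⟨g0, hg0⟩ := hρ e
  obtain ⟨f, hff, hqf, hιf⟩ : ∃ f : G, (∀ x : L', f • f • x = f • x) ∧
      (∀ x, q (f • x) = e • q x) ∧ (∀ y, ι (e • y) = f • ι y) := by
    have h3 : ∀ y : L, ρ (3 * g0 * g0 - 2 * g0 * g0 * g0) • y = e • y := by
      intro y
      simp only [map_sub, map_mul, hg0, map_ofNat, sub_smul, mul_smul, hid]
      rw [← sub_smul]; norm_num
    have h4 : ∀ x : L', (g0 * g0 - g0) • (g0 * g0 - g0) • x = 0 := by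
      intro x
      obtain ⟨y, hy⟩ := hex ((g0 * g0 - g0) • x) (by
        rw [hqG, map_sub, map_mul, hg0, sub_smul, mul_smul, hid, sub_self])
      rw [hy, ← hιG, map_sub, map_mul, hg0, sub_smul, mul_smul, hid, sub_self, map_zero]
    refine ⟨3 * g0 * g0 - 2 * g0 * g0 * g0, ?_, ?_, ?_⟩
    · intro x
      have h5 : (3 * g0 * g0 - 2 * g0 * g0 * g0) * (3 * g0 * g0 - 2 * g0 * g0 * g0)
          - (3 * g0 * g0 - 2 * g0 * g0 * g0)
          = (4 * g0 * g0 - 4 * g0 - 3) * ((g0 * g0 - g0) * (g0 * g0 - g0)) := by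
        noncomm_ring
      rw [← mul_smul, ← sub_eq_zero, ← sub_smul, h5, mul_smul, mul_smul, h4, smul_zero]
    · intro x; rw [hqG, h3]
    · intro y; rw [← hιG, h3]
  clear g0 hg0
  have her : ∀ (r : R) (y : L), e • r • y = r • e • y := fun r y => smul_algebra_smul_comm r e y
  -- Gamma
  let Γ : Subring (G × R) :=
    RingHom.eqLocus (ρ.comp (RingHom.fst G R)) ((algebraMap R 𝓑).comp (RingHom.snd G R))
  have hΓ : ∀ g : Γ, ρ g.1.1 = algebraMap R 𝓑 g.1.2 := fun g => g.2
  have hιΓ0 : ∀ (g : Γ) (y : L), g.1.1 • ι y = ι (g.1.2 • y) := by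
    intro g y; rw [← hιG, hΓ, algebraMap_smul]
  have hqΓ0 : ∀ (g : Γ) (x : L'), q (g.1.1 • x) = g.1.2 • q x := by
    intro g y; rw [hqG, hΓ, algebraMap_smul]
  let N' : AddSubgroup L' :=
    { carrier := {x | f • x = x}
      add_mem' := by intro x y hx hy; simp only [Set.mem_ofPred_eq] at *; rw [smul_add, hx, hy]
      zero_mem' := by simp
      neg_mem' := by intro x hx; simp only [Set.mem_ofPred_eq] at *; rw [smul_neg, hx] }
  have hN' : ∀ x : N', f • (x : L') = x := fun x => x.2
  have heq : ∀ x : N', e • q (x : L') = q x := fun x => by rw [← hqf, hN']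
  have hkey : ∀ (g g' : Γ) (x : N'), f • g.1.1 • f • g'.1.1 • (x : L') = f • g.1.1 • g'.1.1 • (x : L') := by
    intro g g' x
    obtain ⟨y, hy⟩ := hex (f • g'.1.1 • (x : L') - g'.1.1 • (x : L')) (by
      rw [map_sub, hqf, hqΓ0, her, ← hqf, hN', sub_self])
    have h0 : e • y = 0 := by
      apply hι
      rw [hιf, ← hy, smul_sub, hff, sub_self, map_zero]
    rw [← sub_eq_zero, ← smul_sub, ← smul_sub, hy, hιΓ0, ← hιf, her, h0, smul_zero, map_zero]
  let mΓ : Module Γ N' :=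
    { smul := fun g x => ⟨f • g.1.1 • (x : L'), hff _⟩
      one_smul := fun x => Subtype.ext (by
        change f • (1 : G) • (x : L') = x
        rw [one_smul, hN'])
      mul_smul := fun g g' x => Subtype.ext (by
        change f • (g.1.1 * g'.1.1) • (x : L') = f • g.1.1 • f • g'.1.1 • (x : L')
        rw [hkey, mul_smul])
      smul_zero := fun g => Subtype.ext (by
        change f • g.1.1 • (0 : L') = 0
        rw [smul_zero, smul_zero])
      smul_add := fun g x y => Subtype.ext (by
        change f • g.1.1 • ((x : L') + y) = f • g.1.1 • (x : L') + f • g.1.1 • (y : L')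
        rw [smul_add, smul_add])
      add_smul := fun g g' x => Subtype.ext (by
        change f • (g.1.1 + g'.1.1) • (x : L') = f • g.1.1 • (x : L') + f • g'.1.1 • (x : L')
        rw [add_smul, smul_add])
      zero_smul := fun x => Subtype.ext (by
        change f • (0 : G) • (x : L') = 0
        rw [zero_smul, smul_zero]) }
  have hsm : ∀ (g : Γ) (x : N'), ((g • x : N') : L') = f • g.1.1 • (x : L') := fun g x => rfl
  -- Lambda
  let J : Ideal R := maximalIdeal R ^ (N + N)
  let Λ := R ⧸ J
  let 𝔫 : Ideal Λ := (maximalIdeal R).map (Ideal.Quotient.mk J)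
  have hnil : IsNilpotent 𝔫 := ⟨N + N, by
    rw [← Ideal.map_pow]
    exact Ideal.map_quotient_self J⟩
  have hJm : J ≤ maximalIdeal R := Ideal.pow_le_self (by omega)
  have hmem : ∀ r : R, Ideal.Quotient.mk J r ∈ 𝔫 ↔ r ∈ maximalIdeal R := by
    intro r
    constructor
    · intro h
      have h2 : r ∈ 𝔫.comap (Ideal.Quotient.mk J) := h
      rw [Ideal.comap_map_of_surjective' _ Ideal.Quotient.mk_surjective, Ideal.mk_ker] at h2
      rwa [sup_eq_left.2 hJm] at h2
    · intro h; exact Ideal.mem_map_of_mem _ h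
  let g : ResidueField R →+* Λ ⧸ 𝔫 :=
    Ideal.quotientMap 𝔫 (Ideal.Quotient.mk J) Ideal.le_comap_map
  obtain ⟨φ, hφ⟩ := nilp_section hp (B := Λ) (κ := ResidueField R) (by
    rw [← map_natCast (Ideal.Quotient.mk J), hpR, map_zero]) 𝔫 hnil g
  let aK : Algebra (ResidueField R) Λ := φ.toAlgebra
  have hK : ∀ l : Λ, ∃ c : ResidueField R, l - algebraMap (ResidueField R) Λ c ∈ 𝔫 := by
    intro l
    obtain ⟨r, rfl⟩ := Ideal.Quotient.mk_surjective l
    refine ⟨residue R r, ?_⟩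
    rw [← Ideal.Quotient.eq_zero_iff_mem, map_sub, sub_eq_zero]
    have := RingHom.congr_fun hφ (residue R r)
    rw [RingHom.comp_apply] at this
    change _ = Ideal.Quotient.mk 𝔫 (φ (residue R r))
    rw [this]
    exact (Ideal.quotientMap_mk (I := 𝔫) (J := maximalIdeal R) (f := Ideal.Quotient.mk J) (H := Ideal.le_comap_map) (x := r)).symm
  -- N
  let NN := LinearMap.range (Algebra.lsmul R R L e)
  have hNN : ∀ y : NN, e • (y : L) = y := by
    rintro ⟨_, y, rfl⟩; exact hid y
  have htors : Module.IsTorsionBySet R NN (J : Set R) := by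
    rintro y ⟨r, hr⟩
    exact Subtype.ext (hN r (Ideal.pow_le_pow_right (by omega) hr) y)
  let mΛ : Module Λ NN := htors.module
  have tΛ : IsScalarTower R Λ NN := htors.isScalarTower
  have hmk : ∀ (r : R) (y : NN), (Ideal.Quotient.mk J r) • y = r • y := fun r y => htors.mk_smul r y
  let mK : Module (ResidueField R) NN := Module.compHom NN φ
  have tK : IsScalarTower (ResidueField R) Λ NN := ⟨fun k l y => by
    rw [Algebra.smul_def, mul_smul]; rfl⟩
  have hlΛ : Module.length Λ NN = (b : ℕ) := by
    rw [← hlen]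
    exact (Module.length_eq_of_surjective Ideal.Quotient.mk_surjective).symm
  have hlK : Module.length (ResidueField R) NN = (b : ℕ) := by
    rw [← hlΛ]
    refine length_eq_coeff 𝔫 hnil hK ?_
    rw [← Module.length_ne_top_iff, hlΛ]
    exact ENat.natCast_ne_top _
  have hfinK : Module.Finite (ResidueField R) NN := by
    have : IsFiniteLength (ResidueField R) NN := by
      rw [← Module.length_ne_top_iff, hlK]
      exact ENat.natCast_ne_top _
    rw [isFiniteLength_iff_isNoetherian_isArtinian] at this
    have := this.1
    infer_instance
  have hfr : Module.finrank (ResidueField R) NN = b := by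
    rw [Module.length_eq_finrank] at hlK
    exact_mod_cast hlK
  -- final
  have hlift : ∀ r ∈ maximalIdeal R ^ N * maximalIdeal R ^ N, ∃ g : G, ρ g = algebraMap R 𝓑 r ∧
      ∀ x : L', g • x = 0 := by
    intro r hr
    refine Submodule.mul_induction_on hr ?_ ?_
    · intro s hs t ht
      obtain ⟨gs, hgs⟩ := hρ (algebraMap R 𝓑 s)
      obtain ⟨gt, hgt⟩ := hρ (algebraMap R 𝓑 t)
      refine ⟨gs * gt, by rw [map_mul, hgs, hgt, map_mul], fun x => ?_⟩
      obtain ⟨y, hy⟩ := hex (gt • x) (by rw [hqG, hgt, algebraMap_smul, hN t ht])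
      rw [mul_smul, hy, ← hιG, hgs, algebraMap_smul, hN s hs, map_zero]
    · rintro s t ⟨gs, h1, h2⟩ ⟨gt, h3, h4⟩
      exact ⟨gs + gt, by rw [map_add, h1, h3, map_add], fun x => by rw [add_smul, h2, h4, add_zero]⟩
  have hmain := core_trace (K := ResidueField R) (Λ := Λ) (Γ := Γ) (N := NN) (N' := N') 𝔫 hnil hK
    ((Ideal.Quotient.mk J).comp ((RingHom.snd G R).comp Γ.subtype))
    (by
      intro l
      obtain ⟨r, rfl⟩ := Ideal.Quotient.mk_surjective l
      obtain ⟨g, hg⟩ := hρ (algebraMap R 𝓑 r)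
      exact ⟨⟨(g, r), hg⟩, rfl⟩)
    { toFun := fun y => ⟨ι y, by change f • ι (y : L) = ι y; rw [← hιf, hNN]⟩
      map_zero' := Subtype.ext (by simp)
      map_add' := fun x y => Subtype.ext (by simp) }
    { toFun := fun x => ⟨q x, q x, by change e • q (x : L') = q x; rw [← hqf, hN']⟩
      map_zero' := Subtype.ext (by simp)
      map_add' := fun x y => Subtype.ext (by simp) }
    (by
      intro x y hxy
      exact Subtype.ext (hι (congrArg Subtype.val hxy)))
    (by
      rintro ⟨_, y, rfl⟩
      obtain ⟨x, rfl⟩ := hq y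
      exact ⟨⟨f • x, hff x⟩, Subtype.ext (hqf x)⟩)
    (by
      intro x hx
      obtain ⟨y, hy⟩ := hex x (congrArg Subtype.val hx)
      refine ⟨⟨y, y, ?_⟩, Subtype.ext hy⟩
      change e • y = y
      apply hι
      rw [hιf, ← hy, hN'])
    (by
      intro g x
      apply Subtype.ext
      change q (f • g.1.1 • (x : L')) = ((Ideal.Quotient.mk J g.1.2 • (⟨q x, _⟩ : NN) : NN) : L)
      rw [hmk]
      change q (f • g.1.1 • (x : L')) = g.1.2 • q (x : L')
      rw [hqf, hqΓ0, her, heq])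
    (by
      intro g y
      apply Subtype.ext
      change ι ((Ideal.Quotient.mk J g.1.2 • y : NN) : L) = f • g.1.1 • ι (y : L)
      rw [hmk, hιΓ0, ← hιf, her, hNN]
      rfl)
    (by
      intro g hg
      have hgJ : g.1.2 ∈ maximalIdeal R ^ N * maximalIdeal R ^ N := by
        rw [← pow_add]
        exact Ideal.Quotient.eq_zero_iff_mem.1 hg
      obtain ⟨g', h1, h2⟩ := hlift _ hgJ
      obtain ⟨β, hβ⟩ := hkerG (g.1.1 - g') (by rw [map_sub, hΓ, h1, sub_self])
      obtain ⟨r, hr⟩ := heβ β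
      refine ⟨Ideal.Quotient.mk J r, fun x => Subtype.ext ?_⟩
      change f • g.1.1 • (x : L') = ι ((Ideal.Quotient.mk J r • (⟨q x, _⟩ : NN) : NN) : L)
      rw [hmk]
      have h3 := hβ x
      rw [sub_smul, h2, sub_zero] at h3
      have h5 := hr (q x)
      rw [heq] at h5
      rw [h3, ← hιf, h5]
      rfl)
    ⟨(g₁, r₁), hg₁⟩ ⟨(g₂, r₂), hg₂⟩ ((hmem r₁).2 hr₁) ((hmem r₂).2 hr₂)
    (Ideal.Quotient.mk J c) (fun h => hc ((hmem c).1 h))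
    (by
      intro x
      apply Subtype.ext
      change f • (g₁ * g₂ - g₂ * g₁) • (x : L') =
        ι ((Ideal.Quotient.mk J c • (⟨q x, _⟩ : NN) : NN) : L)
      rw [hmk]
      change f • (g₁ * g₂ - g₂ * g₁) • (x : L') = ι (c • q (x : L'))
      rw [hcomm, ← hιf, her, heq])
  rw [hfr] at hmain
  by_contra hpb
  have hcop : IsCoprime (p : ℤ) (b : ℤ) := Nat.isCoprime_iff_coprime.2 ((Nat.Prime.coprime_iff_not_dvd hp).2 hpb)
  obtain ⟨u, v, huv⟩ := hcop
  have h1 : ((u * p + v * b : ℤ) : ResidueField R) = 1 := by rw [huv]; simp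
  have hpK : (p : ResidueField R) = 0 := by
    rw [← map_natCast (residue R), hpR, map_zero]
  push_cast at h1
  rw [hmain, hpK] at h1
  simp at h1

theorem exists_dual_not_mem {Z A : Type*} [CommRing Z] [Ring A] [Algebra Z A]
    [Module.Projective Z A] (Q : Ideal Z) [Q.IsPrime] (x : A)
    (hx : (1 : Q.ResidueField) ⊗ₜ[Z] x ≠ 0) : ∃ g : A →ₗ[Z] Z, g x ∉ Q := by
  by_contra hcon
  push Not at hcon
  apply hx
  obtain ⟨s, hs⟩ := Module.projective_def'.1 (inferInstance : Module.Projective Z A)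
  have h1 := LinearMap.congr_fun hs x
  rw [LinearMap.comp_apply, Finsupp.linearCombination_apply, LinearMap.id_apply] at h1
  rw [← h1, Finsupp.sum, TensorProduct.tmul_sum]
  refine Finset.sum_eq_zero fun i _ => ?_
  rw [← TensorProduct.smul_tmul, Algebra.smul_def, mul_one]
  have h2 : algebraMap Z Q.ResidueField (s x i) = 0 := by
    rw [Ideal.algebraMap_residueField_eq_zero]
    exact hcon ((Finsupp.lapply i).comp s)
  rw [h2, TensorProduct.zero_tmul]

theorem fibre_simple {Z A : Type*} [CommRing Z] [Ring A] [Algebra Z A] (haz : IsAzumayaOver Z A)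
    (Q : Ideal Z) [Q.IsPrime] [Nontrivial (Q.ResidueField ⊗[Z] A)] :
    IsSimpleRing (Q.ResidueField ⊗[Z] A) := by
  obtain ⟨_, _, _, hbij⟩ := haz
  refine ⟨⟨fun I => ?_⟩⟩
  by_cases hI : I = ⊥
  · exact Or.inl hI
  right
  obtain ⟨t, htI, ht0⟩ : ∃ t ∈ I, t ≠ 0 := by
    by_contra hcon
    push Not at hcon
    apply hI
    rw [eq_bot_iff]
    intro t ht
    rw [hcon t ht]
    exact zero_mem _
  have hsmul : ∀ (k : Q.ResidueField) (t : Q.ResidueField ⊗[Z] A), t ∈ I → k • t ∈ I := by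
    intro k t ht
    rw [Algebra.smul_def]
    exact I.mul_mem_left _ _ ht
  obtain ⟨x, hxI, hx0⟩ : ∃ x : A, (1 : Q.ResidueField) ⊗ₜ[Z] x ∈ I ∧ (1 : Q.ResidueField) ⊗ₜ[Z] x ≠ 0 := by
    let f : Localization.AtPrime Q →ₗ[Z] Q.ResidueField :=
      (IsScalarTower.toAlgHom Z (Localization.AtPrime Q) Q.ResidueField).toLinearMap
    have hf : Function.Surjective f := IsLocalRing.residue_surjective
    obtain ⟨t', ht'⟩ := LinearMap.rTensor_surjective A hf t
    obtain ⟨⟨x, s⟩, hxs⟩ := IsLocalizedModule.surj Q.primeCompl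
      (TensorProduct.mk Z (Localization.AtPrime Q) A 1) t'
    have h1 : (algebraMap Z Q.ResidueField s) • t = (1 : Q.ResidueField) ⊗ₜ[Z] x := by
      rw [algebraMap_smul, ← ht', ← map_smul]
      change LinearMap.rTensor A f (s • t') = _
      rw [hxs]
      change (f 1) ⊗ₜ[Z] x = _
      congr 1
    refine ⟨x, ?_, ?_⟩
    · rw [← h1]; exact hsmul _ _ htI
    · rw [← h1]
      refine smul_ne_zero ?_ ht0
      rw [Ne, Ideal.algebraMap_residueField_eq_zero]
      exact s.2
  obtain ⟨g, hg⟩ := exists_dual_not_mem Q x hx0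
  obtain ⟨T, hT⟩ := hbij.2 ((Algebra.linearMap Z A).comp g)
  have h2 : ∀ T, (1 : Q.ResidueField) ⊗ₜ[Z] (azumayaMap Z A T x) ∈ I := by
    intro T
    induction T with
    | zero => simp [zero_mem]
    | add T T' h h' => rw [map_add, LinearMap.add_apply, TensorProduct.tmul_add]; exact I.add_mem h h'
    | tmul a b =>
      have : (1 : Q.ResidueField) ⊗ₜ[Z] (azumayaMap Z A (a ⊗ₜ b) x)
        = ((1 : Q.ResidueField) ⊗ₜ[Z] a) * (((1 : Q.ResidueField) ⊗ₜ[Z] x) *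
          ((1 : Q.ResidueField) ⊗ₜ[Z] b.unop)) := by
        simp [azumayaMap]
      rw [this]
      exact I.mul_mem_left _ _ (I.mul_mem_right _ _ hxI)
  have h3 := h2 T
  rw [hT] at h3
  have h4 : (1 : Q.ResidueField) ⊗ₜ[Z] (((Algebra.linearMap Z A).comp g) x)
      = algebraMap Z Q.ResidueField (g x) • (1 : Q.ResidueField ⊗[Z] A) := by
    rw [algebraMap_smul, LinearMap.comp_apply, Algebra.linearMap_apply, Algebra.algebraMap_eq_smul_one,
      TensorProduct.tmul_smul]
    rfl
  rw [h4] at h3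
  have h5 := hsmul (algebraMap Z Q.ResidueField (g x))⁻¹ _ h3
  rw [smul_smul, inv_mul_cancel₀ (by rwa [Ne, Ideal.algebraMap_residueField_eq_zero]), one_smul] at h5
  rw [eq_top_iff]
  intro y _
  have := I.mul_mem_left y 1 h5
  rwa [mul_one] at this

/-- The reduction map. -/
noncomputable def fibreMap (Z A : Type*) [CommRing Z] [Ring A] [Algebra Z A] (Q : Ideal Z) [Q.IsPrime] :
    (Localization.AtPrime Q ⊗[Z] A) →ₐ[Z] (Q.ResidueField ⊗[Z] A) :=
  Algebra.TensorProduct.map (IsScalarTower.toAlgHom Z (Localization.AtPrime Q) Q.ResidueField)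
    (AlgHom.id Z A)

theorem fibreMap_surj (Z A : Type*) [CommRing Z] [Ring A] [Algebra Z A] (Q : Ideal Z) [Q.IsPrime] :
    Function.Surjective (fibreMap Z A Q) := by
  have hf : Function.Surjective
    (IsScalarTower.toAlgHom Z (Localization.AtPrime Q) Q.ResidueField).toLinearMap :=
    IsLocalRing.residue_surjective
  exact LinearMap.rTensor_surjective A hf

theorem fibreMap_algebraMap (Z A : Type*) [CommRing Z] [Ring A] [Algebra Z A] (Q : Ideal Z) [Q.IsPrime]
    (r : Localization.AtPrime Q) :
    fibreMap Z A Q (algebraMap _ _ r) = algebraMap Q.ResidueField _ (IsLocalRing.residue _ r) := by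
  rw [Algebra.TensorProduct.algebraMap_apply, Algebra.TensorProduct.algebraMap_apply]
  simp [fibreMap]

theorem fibreMap_ker (Z A : Type*) [CommRing Z] [Ring A] [Algebra Z A] (Q : Ideal Z) [Q.IsPrime]
    (x : Localization.AtPrime Q ⊗[Z] A) :
    fibreMap Z A Q x = 0 ↔ x ∈ (IsLocalRing.maximalIdeal (Localization.AtPrime Q) •
      (⊤ : Submodule (Localization.AtPrime Q) (Localization.AtPrime Q ⊗[Z] A))) := by
  constructor
  · intro hx
    let R := Localization.AtPrime Q
    let m := IsLocalRing.maximalIdeal R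
    let f : m →ₗ[Z] R := (Submodule.subtype m).restrictScalars Z
    have hfg : Function.Exact f
      (IsScalarTower.toAlgHom Z (Localization.AtPrime Q) Q.ResidueField).toLinearMap := by
      intro y
      constructor
      · intro hy
        exact ⟨⟨y, (IsLocalRing.residue_eq_zero_iff y).1 hy⟩, rfl⟩
      · rintro ⟨y, rfl⟩
        exact (IsLocalRing.residue_eq_zero_iff _).2 y.2
    obtain ⟨y, rfl⟩ := (rTensor_exact A hfg IsLocalRing.residue_surjective x).1 hx
    clear hx
    induction y with
    | zero => simp
    | add y y' h h' => rw [map_add]; exact add_mem h h'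
    | tmul r a =>
      have : (LinearMap.rTensor A f) (r ⊗ₜ[Z] a) = (r : R) • ((1 : R) ⊗ₜ[Z] a) := by
        rw [LinearMap.rTensor_tmul, TensorProduct.smul_tmul', smul_eq_mul, mul_one]; rfl
      rw [this]
      exact Submodule.smul_mem_smul r.2 trivial
  · intro hx
    refine Submodule.smul_induction_on hx ?_ ?_
    · intro r hr y _
      have h1 : r • y = algebraMap (Localization.AtPrime Q) (Localization.AtPrime Q ⊗[Z] A) r * y :=
        Algebra.smul_def r y
      rw [h1, map_mul, fibreMap_algebraMap, (IsLocalRing.residue_eq_zero_iff r).2 hr,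
        map_zero, zero_mul]
    · intro x y hx hy; rw [map_add, hx, hy, add_zero]

/-- The subring of pairs (operator on the deformation, its symbol). -/
def pairRing {C A' R 𝓑 L' : Type*} [CommRing C] [CommRing R] [Ring A'] [Ring 𝓑] [Algebra R 𝓑]
    [AddCommGroup L'] [Module C L'] (S : Submonoid C) (j : C →+* A')
    (γ : C →+* R) (OP : A' →+* Module.End C L') (U : A' →+* 𝓑)
    (hOPj : ∀ c, OP (j c) = algebraMap C _ c) (hUj : ∀ c, U (j c) = algebraMap R 𝓑 (γ c)) :
    Subring (Module.End C L' × 𝓑) where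
  carrier := {x | ∃ σ ∈ S, ∃ a : A', σ • x.1 = OP a ∧ γ σ • x.2 = U a}
  mul_mem' := by
    rintro x y ⟨σ, hσ, a, h1, h2⟩ ⟨τ, hτ, b, h3, h4⟩
    refine ⟨σ * τ, S.mul_mem hσ hτ, a * b, ?_, ?_⟩
    · rw [map_mul, ← h1, ← h3, Prod.fst_mul, smul_mul_smul_comm]
    · rw [map_mul, map_mul, ← h2, ← h4, Prod.snd_mul, smul_mul_smul_comm]
  one_mem' := ⟨1, S.one_mem, 1, by simp, by simp⟩
  add_mem' := by
    rintro x y ⟨σ, hσ, a, h1, h2⟩ ⟨τ, hτ, b, h3, h4⟩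
    refine ⟨σ * τ, S.mul_mem hσ hτ, j τ * a + j σ * b, ?_, ?_⟩
    · rw [map_add, map_mul, map_mul, ← h1, ← h3, hOPj, hOPj, ← Algebra.smul_def,
        ← Algebra.smul_def, Prod.fst_add, smul_add, smul_smul, smul_smul, mul_comm τ σ]
    · rw [map_add, map_mul, map_mul, map_mul, ← h2, ← h4, hUj, hUj, ← Algebra.smul_def,
        ← Algebra.smul_def, Prod.snd_add, smul_add, smul_smul, smul_smul, mul_comm (γ τ) (γ σ)]
  zero_mem' := ⟨1, S.one_mem, 0, by simp, by simp⟩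
  neg_mem' := by
    rintro x ⟨σ, hσ, a, h1, h2⟩
    exact ⟨σ, hσ, -a, by rw [map_neg, ← h1]; simp, by rw [map_neg, ← h2]; simp⟩

open IsLocalRing in
theorem conc_abs {C A' R 𝓑 L L' : Type*} [CommRing C] [CommRing R] [IsLocalRing R] [Ring A']
    [Ring 𝓑] [Algebra R 𝓑] [AddCommGroup L] [Module 𝓑 L] [Module R L] [IsScalarTower R 𝓑 L]
    [AddCommGroup L'] [Module C L'] {p b : ℕ} (hp : p.Prime) (hpR : (p : R) = 0) (N : ℕ)
    (hN0 : N ≠ 0) (hN : ∀ r ∈ maximalIdeal R ^ N, ∀ w : L, r • w = 0)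
    (e : 𝓑) (hid : ∀ w : L, e • e • w = e • w)
    (heβ : ∀ β : 𝓑, ∃ r : R, ∀ w : L, e • β • e • w = r • e • w)
    (hlen : Module.length R (LinearMap.range (Algebra.lsmul R R L e)) = (b : ℕ))
    (S : Submonoid C) (j : C →+* A')
    (γ : C →+* R) (OP : A' →+* Module.End C L') (U : A' →+* 𝓑)
    (hOPj : ∀ c, OP (j c) = algebraMap C _ c) (hUj : ∀ c, U (j c) = algebraMap R 𝓑 (γ c))
    (hγ : ∀ σ ∈ S, IsUnit (γ σ)) (hS : ∀ σ ∈ S, IsUnit (algebraMap C (Module.End C L') σ))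
    (ι : L →+ L') (q : L' →+ L) (hι : Function.Injective ι) (hq : Function.Surjective q)
    (hex : ∀ x, q x = 0 → ∃ y, x = ι y)
    (hqU : ∀ a x, q (OP a x) = U a • q x) (hιU : ∀ a y, ι (U a • y) = OP a (ι y))
    (hU1 : ∀ β, ∃ σ ∈ S, ∃ a, γ σ • β = U a)
    (hU2 : ∀ a, U a = 0 → ∃ τ ∈ S, ∃ y, ∀ x, τ • OP a x = ι (U y • q x))
    (a₁ a₂ : A') (r₁ r₂ : R) (hr₁ : r₁ ∈ maximalIdeal R) (hr₂ : r₂ ∈ maximalIdeal R)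
    (hg₁ : U a₁ = algebraMap R 𝓑 r₁) (hg₂ : U a₂ = algebraMap R 𝓑 r₂)
    (c : R) (hc : c ∉ maximalIdeal R)
    (hcomm : ∀ x, OP (a₁ * a₂ - a₂ * a₁) x = ι (c • q x)) :
    p ∣ b := by
  have hqC : ∀ (c : C) x, q (c • x) = γ c • q x := by
    intro c x
    have := hqU (j c) x
    rw [hOPj, hUj] at this
    simpa [Module.algebraMap_end_apply] using this
  have hιC : ∀ (c : C) y, ι (γ c • y) = c • ι y := by
    intro c y
    have := hιU (j c) y
    rw [hOPj, hUj] at this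
    simpa [Module.algebraMap_end_apply] using this
  have hcan : ∀ σ ∈ S, ∀ x y : L', σ • x = σ • y → x = y := by
    intro σ hσ x y hxy
    have := ((Module.End.isUnit_iff _).mp (hS σ hσ)).1
    exact this (by simpa [Module.algebraMap_end_apply] using hxy)
  let G := pairRing S j γ OP U hOPj hUj
  let _ : Module G L' := Module.compHom L' ((RingHom.fst (Module.End C L') 𝓑).comp G.subtype)
  have hact : ∀ (g : G) (x : L'), g • x = g.1.1 x := fun g x => rfl
  refine abs_contra (G := G) (L := L) (L' := L') hp hpR N hN0 hN e hid heβ hlen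
    ((RingHom.snd (Module.End C L') 𝓑).comp G.subtype) ?_ ι q hι hq hex ?_ ?_ ?_
    ⟨(OP a₁, U a₁), 1, S.one_mem, a₁, by simp, by simp⟩
    ⟨(OP a₂, U a₂), 1, S.one_mem, a₂, by simp, by simp⟩ r₁ r₂ hr₁ hr₂ hg₁ hg₂ c hc ?_
  · intro β
    obtain ⟨σ, hσ, a, ha⟩ := hU1 β
    obtain ⟨w, hw⟩ := hS σ hσ
    refine ⟨⟨((w⁻¹ : (Module.End C L')ˣ) * OP a, β), σ, hσ, a, ?_, ha⟩, rfl⟩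
    rw [Algebra.smul_def, ← hw, ← mul_assoc, Units.mul_inv, one_mul]
  · rintro ⟨⟨φ, β⟩, σ, hσ, a, h1, h2⟩ x
    rw [hact]
    change q (φ x) = β • q x
    have h3 : γ σ • q (φ x) = γ σ • (β • q x) := by
      rw [← hqC, ← LinearMap.smul_apply]
      dsimp only at h1 h2
      rw [h1, hqU, ← h2, smul_assoc]
    exact (hγ σ hσ).smul_left_cancel.mp h3
  · rintro ⟨⟨φ, β⟩, σ, hσ, a, h1, h2⟩ y
    rw [hact]
    change ι (β • y) = φ (ι y)
    apply hcan σ hσ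
    dsimp only at h1 h2
    rw [← hιC, ← smul_assoc, h2, hιU, ← LinearMap.smul_apply, h1]
  · rintro ⟨⟨φ, β⟩, σ, hσ, a, h1, h2⟩ h0
    change β = 0 at h0
    subst h0
    dsimp only at h1 h2
    rw [smul_zero] at h2
    obtain ⟨τ, hτ, y, hy⟩ := hU2 a h2.symm
    obtain ⟨w, hw⟩ := hγ (τ * σ) (S.mul_mem hτ hσ)
    refine ⟨((w⁻¹ : Rˣ) : R) • U y, fun x => ?_⟩
    rw [hact]
    change φ x = _
    apply hcan (τ * σ) (S.mul_mem hτ hσ)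
    rw [← hιC, ← smul_assoc, ← hw, smul_smul, Units.mul_inv, one_smul, ← hy, ← h1, mul_smul]
    rfl
  · intro x
    rw [hact, ← hcomm, map_sub, map_mul, map_mul]
    rfl

open IsLocalRing in
theorem conc_loc {C A' A Z R 𝓑 L M M' : Type*} [CommRing C] [CommRing Z] [CommRing R]
    [IsLocalRing R] [Algebra Z R] [Ring A'] [Ring A] [Algebra Z A]
    [Ring 𝓑] [Algebra R 𝓑] [AddCommGroup L] [Module 𝓑 L] [Module R L] [IsScalarTower R 𝓑 L]
    [AddCommGroup M] [Module A M] [Module Z M] [IsScalarTower Z A M]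
    [AddCommGroup M'] [Module A' M'] [Module C M] [Module C L] [Module C M']
    {p b : ℕ} (hp : p.Prime) (hpR : (p : R) = 0) (N : ℕ)
    (hN0 : N ≠ 0) (hN : ∀ r ∈ maximalIdeal R ^ N, ∀ w : L, r • w = 0)
    (e : 𝓑) (hid : ∀ w : L, e • e • w = e • w)
    (heβ : ∀ β : 𝓑, ∃ r : R, ∀ w : L, e • β • e • w = r • e • w)
    (hlen : Module.length R (LinearMap.range (Algebra.lsmul R R L e)) = (b : ℕ))
    -- localization data
    (S : Submonoid Z) (hSu : ∀ s ∈ S, IsUnit (algebraMap Z R s))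
    (u : A →+* 𝓑) (u1 : ∀ β, ∃ s ∈ S, ∃ a, algebraMap Z R s • β = u a)
    (u2 : ∀ a, u a = 0 → ∃ s ∈ S, s • a = 0)
    (u3 : ∀ z, u (algebraMap Z A z) = algebraMap R 𝓑 (algebraMap Z R z))
    (v : M →+ L) (v0 : ∀ a m, v (a • m) = u a • v m)
    (v1 : ∀ y, ∃ s ∈ S, ∃ m, algebraMap Z R s • y = v m)
    (v2 : ∀ m, v m = 0 → ∃ s ∈ S, s • m = 0)
    -- deformation data
    (h : A') (π : A' →+* A) (hcen : ∀ x : A', h * x = x * h) (hπ : Function.Surjective π)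
    (hker : ∀ x : A', π x = 0 ↔ ∃ y : A', x = h * y)
    (q : M' →+ M) (hq : Function.Surjective q) (hqπ : ∀ (a : A') (x : M'), q (a • x) = π a • q x)
    (hqk : ∀ x : M', q x = 0 ↔ ∃ y : M', x = h • y)
    (hqh : ∀ x : M', h • x = 0 ↔ ∃ y : M', x = h • y)
    -- central data
    (j : C →+* A') (hj : ∀ c a, j c * a = a * j c) (θ : C →+* Z)
    (hθ : ∀ c, algebraMap Z A (θ c) = π (j c)) (hθp : ∀ s : Z, ∃ c, θ c = s ^ p)
    (hCM : ∀ (c : C) (m : M), c • m = θ c • m)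
    (hCL : ∀ (c : C) (y : L), c • y = algebraMap Z R (θ c) • y)
    (hCM' : ∀ (c : C) (x : M'), c • x = j c • x)
    -- elements
    (a₁ a₂ c : A') (z₁ z₂ z : Z) (hz₁ : π a₁ = algebraMap Z A z₁) (hz₂ : π a₂ = algebraMap Z A z₂)
    (hz : π c = algebraMap Z A z) (hr₁ : algebraMap Z R z₁ ∈ maximalIdeal R)
    (hr₂ : algebraMap Z R z₂ ∈ maximalIdeal R) (hc : algebraMap Z R z ∉ maximalIdeal R)
    (hcomm : a₁ * a₂ - a₂ * a₁ = h * c) : p ∣ b := by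
  obtain ⟨P, rfl⟩ : ∃ P, p = P + 1 := ⟨p - 1, by have := hp.pos; omega⟩
  have hsA : ∀ (z : Z) (m : M), z • m = algebraMap Z A z • m := fun z m => by
    rw [algebraMap_smul]
  have hsp : ∀ s ∈ S, ∃ σ ∈ S.comap θ, θ σ = s ^ P * s := by
    intro s hs
    obtain ⟨σ, hσ⟩ := hθp s
    refine ⟨σ, ?_, by rw [hσ, pow_succ]⟩
    rw [Submonoid.mem_comap, hσ]
    exact S.pow_mem hs _
  have hθu : ∀ σ ∈ S.comap θ, IsUnit (algebraMap Z R (θ σ)) := fun σ hσ => hSu _ hσ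
  have hvz : ∀ (z : Z) m, v (z • m) = algebraMap Z R z • v m := by
    intro z m
    rw [hsA, v0, u3, algebraMap_smul]
  -- v as a localization
  let vC : M →ₗ[C] L :=
    { v with
      map_smul' := fun c m => by
        change v (c • m) = c • v m
        rw [hCM, hCL, hvz] }
  have hvC : ∀ m, vC m = v m := fun _ => rfl
  have hlv : IsLocalizedModule (S.comap θ) vC := by
    refine ⟨?_, ?_, ?_⟩
    · rintro ⟨σ, hσ⟩
      rw [Module.End.isUnit_iff]
      obtain ⟨w, hw⟩ := hθu σ hσ
      constructor
      · intro x y hxy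
        simp only [Module.algebraMap_end_apply, hCL] at hxy
        exact (hθu σ hσ).smul_left_cancel.mp hxy
      · intro y
        refine ⟨((w⁻¹ : Rˣ) : R) • y, ?_⟩
        simp only [Module.algebraMap_end_apply, hCL]
        rw [← hw, smul_smul, Units.mul_inv, one_smul]
    · intro y
      obtain ⟨s, hs, m, hm⟩ := v1 y
      obtain ⟨σ, hσ, hσs⟩ := hsp s hs
      refine ⟨(s ^ P • m, ⟨σ, hσ⟩), ?_⟩
      change σ • y = v (s ^ P • m)
      rw [hCL, hσs, hvz, map_mul, mul_smul, hm]
    · intro x₁ x₂ hx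
      have : v (x₁ - x₂) = 0 := by rw [map_sub, sub_eq_zero]; exact hx
      obtain ⟨s, hs, hm⟩ := v2 _ this
      obtain ⟨σ, hσ, hσs⟩ := hsp s hs
      refine ⟨⟨σ, hσ⟩, ?_⟩
      change σ • x₁ = σ • x₂
      rw [← sub_eq_zero, ← smul_sub, hCM, hσs, mul_smul, hm, smul_zero]
  let T := S.comap θ
  let L' := LocalizedModule T M'
  let k : M' →ₗ[C] L' := LocalizedModule.mkLinearMap T M'
  have hqh0 : ∀ x y : M', q x = q y → h • x = h • y := by
    intro x y hxy
    rw [← sub_eq_zero, ← smul_sub, hqh]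
    exact (hqk _).mp (by rw [map_sub, hxy, sub_self])
  let qC : M' →ₗ[C] M :=
    { q with
      map_smul' := fun c x => by
        change q (c • x) = c • q x
        rw [hCM', hCM, hqπ, hsA, hθ] }
  have hqC : ∀ m, qC m = q m := fun _ => rfl
  choose l hl using hq
  let ιC : M →ₗ[C] M' :=
    { toFun := fun m => h • l m
      map_add' := fun m m' => by
        rw [← smul_add]; apply hqh0; rw [map_add, hl, hl, hl]
      map_smul' := fun c m => by
        rw [RingHom.id_apply, hCM', ← mul_smul, ← hcen, mul_smul]
        apply hqh0
        rw [hl, hqπ, hl, hCM, hsA, hθ] }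
  have hιC : ∀ x, ιC (q x) = h • x := fun x => hqh0 _ _ (hl _)
  have hιinj : Function.Injective ιC := by
    rw [injective_iff_map_eq_zero]
    intro m hm
    have h1 : h • l m = 0 := hm
    rw [hqh, ← hqk, hl] at h1
    exact h1
  have hexact : Function.Exact ιC qC := by
    intro x
    rw [hqC, hqk]
    constructor
    · rintro ⟨y, rfl⟩; exact ⟨q y, hιC y⟩
    · rintro ⟨y, rfl⟩; exact ⟨l y, rfl⟩
  let op : A' →+* Module.End C M' :=
    { toFun := fun a =>
        { toFun := fun x => a • x
          map_add' := fun x y => smul_add _ _ _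
          map_smul' := fun c x => by
            rw [RingHom.id_apply, hCM', hCM', ← mul_smul, ← mul_smul, hj] }
      map_one' := by ext x; exact one_smul _ _
      map_mul' := fun a a' => by ext x; exact mul_smul _ _ _
      map_zero' := by ext x; exact zero_smul _ _
      map_add' := fun a a' => by ext x; exact add_smul _ _ _ }
  have hop : ∀ a x, op a x = a • x := fun _ _ => rfl
  let OP : A' →+* Module.End C L' :=
    { toFun := fun a => IsLocalizedModule.map T k k (op a)
      map_one' := by rw [map_one]; exact IsLocalizedModule.map_id T k
      map_mul' := fun a a' => by
        rw [map_mul]; exact IsLocalizedModule.map_comp' T k k k (op a') (op a)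
      map_zero' := by rw [map_zero, map_zero]
      map_add' := fun a a' => by rw [map_add, map_add] }
  have hOP : ∀ a x, OP a (k x) = k (a • x) := fun a x => IsLocalizedModule.map_apply T k k (op a) x
  have hkT : ∀ x : L', ∃ σ ∈ T, ∃ x0, σ • x = k x0 := by
    intro x
    obtain ⟨⟨x0, σ⟩, hx⟩ := IsLocalizedModule.surj T k x
    exact ⟨σ, σ.2, x0, hx⟩
  have hS : ∀ σ ∈ T, IsUnit (algebraMap C (Module.End C L') σ) := fun σ hσ =>
    IsLocalizedModule.map_units k ⟨σ, hσ⟩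
  have hcan : ∀ σ ∈ T, ∀ x y : L', σ • x = σ • y → x = y := fun σ hσ x y hxy =>
    IsLocalizedModule.smul_injective k ⟨σ, hσ⟩ hxy
  have hcanL : ∀ σ ∈ T, ∀ x y : L, σ • x = σ • y → x = y := fun σ hσ x y hxy =>
    IsLocalizedModule.smul_injective vC ⟨σ, hσ⟩ hxy
  let I' : L →ₗ[C] L' := IsLocalizedModule.map T vC k ιC
  let Q' : L' →ₗ[C] L := IsLocalizedModule.map T k vC qC
  have hI' : ∀ m, I' (v m) = k (ιC m) := fun m => IsLocalizedModule.map_apply T vC k ιC m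
  have hQ' : ∀ x, Q' (k x) = v (q x) := fun x => IsLocalizedModule.map_apply T k vC qC x
  have hβC : ∀ (β : 𝓑) (c : C) (y : L), β • c • y = c • β • y := by
    intro β c y
    rw [hCL, hCL]
    exact smul_algebra_smul_comm _ _ _
  refine conc_abs hp hpR N hN0 hN e hid heβ hlen T j ((algebraMap Z R).comp θ) OP (u.comp π)
    ?_ ?_ hθu hS I'.toAddMonoidHom Q'.toAddMonoidHom ?_ ?_ ?_ ?_ ?_ ?_ ?_ a₁ a₂ _ _ hr₁ hr₂
    ?_ ?_ _ hc ?_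
  · intro c
    refine IsLocalizedModule.linearMap_ext T k k ?_
    ext x
    change OP (j c) (k x) = c • k x
    rw [hOP, ← hCM', map_smul]
  · intro c
    change u (π (j c)) = _
    rw [← hθ, u3]; rfl
  · exact IsLocalizedModule.map_injective T vC k ιC hιinj
  · exact IsLocalizedModule.map_surjective T k vC qC (fun m => ⟨l m, hl m⟩)
  · intro x hx
    obtain ⟨y, hy⟩ := (IsLocalizedModule.map_exact T vC k vC ιC qC hexact x).mp hx
    exact ⟨y, hy.symm⟩
  · intro a x
    obtain ⟨σ, hσ, x0, hx⟩ := hkT x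
    change Q' (OP a x) = u (π a) • Q' x
    apply hcanL σ hσ
    rw [← map_smul, ← map_smul, ← hβC, ← map_smul, hx, hOP, hQ', hQ', hqπ, v0]
  · intro a y
    change I' (u (π a) • y) = OP a (I' y)
    obtain ⟨⟨m, σ, hσ⟩, hy⟩ := IsLocalizedModule.surj T vC y
    change σ • y = v m at hy
    apply hcan σ hσ
    rw [← map_smul, ← map_smul, ← map_smul, ← hβC, hy, ← v0, hI', hI', hOP]
    congr 1
    rw [← hl m, ← hqπ, hιC, hιC, ← mul_smul, ← mul_smul, hcen]
  · intro β
    obtain ⟨s, hs, a, ha⟩ := u1 β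
    obtain ⟨σ, hσ, hσs⟩ := hsp s hs
    obtain ⟨a', ha'⟩ := hπ (s ^ P • a)
    refine ⟨σ, hσ, a', ?_⟩
    change algebraMap Z R (θ σ) • β = u (π a')
    rw [hσs, ha', map_mul, mul_smul, ha, Algebra.smul_def, Algebra.smul_def, map_mul, u3]
  · intro a ha
    change u (π a) = 0 at ha
    obtain ⟨s, hs, hm⟩ := u2 _ ha
    obtain ⟨σ, hσ, hσs⟩ := hsp s hs
    have h1 : π (j σ * a) = 0 := by
      rw [map_mul, ← hθ, ← Algebra.smul_def, hσs, mul_smul, hm, smul_zero]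
    obtain ⟨y, hy⟩ := (hker _).mp h1
    refine ⟨σ, hσ, y, fun x => ?_⟩
    obtain ⟨τ, hτ, x0, hx⟩ := hkT x
    change σ • OP a x = I' (u (π y) • Q' x)
    apply hcan τ hτ
    rw [smul_comm τ σ, ← map_smul (OP a), ← map_smul I', ← hβC, ← map_smul Q', hx, hOP,
      hQ', ← v0, hI', ← hqπ, hιC, ← map_smul, hCM', ← mul_smul, ← mul_smul, hy]
  · change u (π a₁) = _
    rw [hz₁, u3]
  · change u (π a₂) = _
    rw [hz₂, u3]
  · intro x
    rw [hcomm]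
    obtain ⟨τ, hτ, x0, hx⟩ := hkT x
    change OP (h * c) x = I' (algebraMap Z R z • Q' x)
    have h2 : ∀ y : L, algebraMap Z R z • y = u (π c) • y := by
      intro y; rw [hz, u3, algebraMap_smul (A := 𝓑) (algebraMap Z R z) y]
    rw [h2]
    apply hcan τ hτ
    rw [← map_smul, ← map_smul, ← hβC, ← map_smul, hx, hOP,
      hQ', ← v0, hI', ← hqπ, hιC, ← mul_smul]

open IsLocalRing in
theorem pow_kills {R : Type*} {L : Type uu} [CommRing R] [IsLocalRing R] [AddCommGroup L] [Module R L]
    (hfl : IsFiniteLength R L) : ∃ N : ℕ, ∀ r ∈ maximalIdeal R ^ N, ∀ w : L, r • w = 0 := by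
  induction hfl with
  | of_subsingleton => exact ⟨0, fun r _ w => Subsingleton.elim _ _⟩
  | @of_simple_quotient M _ _ N hs hfl ih =>
    obtain ⟨k, hk⟩ := ih
    refine ⟨k + 1, fun r hr w => ?_⟩
    have h1 : ∀ x ∈ maximalIdeal R, ∀ w : M, x • w ∈ N := by
      intro x hx w
      have hmax := IsSimpleModule.annihilator_isMaximal (R := R) (M := M ⧸ N)
      rw [← IsLocalRing.eq_maximalIdeal hmax, Module.mem_annihilator] at hx
      have := hx (N.mkQ w)
      rwa [← map_smul, ← LinearMap.mem_ker, Submodule.ker_mkQ] at this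
    rw [pow_succ] at hr
    refine Submodule.mul_induction_on hr (fun x hx y hy => ?_) (fun x y hx hy => ?_)
    · rw [mul_smul]
      have := hk x hx ⟨y • w, h1 y hy w⟩
      simpa [Subtype.ext_iff] using this
    · rw [add_smul, hx, hy, add_zero]

theorem hasModuleLength_length {R L : Type*} [Ring R] [AddCommGroup L] [Module R L] {n : ℕ}
    (hl : HasModuleLength R L n) : Module.length R L = n := by
  obtain ⟨s, h1, h2, h3⟩ := hl
  rw [← h3, Module.length_compositionSeries s h1 h2]

theorem center_pow {A' A : Type*} [Ring A'] [Ring A] (h : A') (π : A' →+* A)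
    (hdef : IsFirstOrderDeformation h π) (p : ℕ) (hp : 0 < p) (hpA : (p : A) = 0) (s : A')
    (hs : π s ∈ Subring.center A) : s ^ p ∈ Subring.center A' := by
  obtain ⟨hcen, hπ, hker, hann⟩ := hdef
  have hph : h * (p : A') = 0 := by
    rw [hann, ← hker, map_natCast, hpA]
  rw [Subring.mem_center_iff] at hs ⊢
  have hh : ∀ x y, π x = π y → h * x = h * y := by
    intro x y hxy
    rw [← sub_eq_zero, ← mul_sub, hann, ← hker, map_sub, hxy, sub_self]
  intro x
  obtain ⟨d, hd⟩ := (hker (s * x - x * s)).mp (by rw [map_sub, map_mul, map_mul, hs, sub_self])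
  have key : ∀ n : ℕ, s ^ (n + 1) * x = x * s ^ (n + 1) + h * ((n + 1 : ℕ) * (s ^ n * d)) := by
    intro n
    induction n with
    | zero =>
      simp only [zero_add, pow_one, pow_zero, one_mul, Nat.cast_one]
      rw [← hd]; abel
    | succ n ih =>
      have h1 : h * (d * s ^ (n + 1)) = h * (s ^ (n + 1) * d) := by
        apply hh
        rw [map_mul, map_mul, map_pow]
        have : ∀ k, π d * π s ^ k = π s ^ k * π d := fun k =>
          (Commute.pow_right (hs (π d)) k)
        exact this _
      have h2 : s * x = x * s + h * d := by rw [← hd]; abel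
      calc s ^ (n + 1 + 1) * x = s * (s ^ (n + 1) * x) := by rw [pow_succ' s (n+1), mul_assoc]
        _ = s * x * s ^ (n + 1) + h * ((n + 1 : ℕ) * (s ^ (n + 1) * d)) := by
            rw [ih, mul_add, mul_assoc s x, ← mul_assoc s h, ← hcen s, mul_assoc h s,
              ← mul_assoc s ((n + 1 : ℕ) : A'), ← Nat.cast_comm (n + 1) s, pow_succ' s n]
            simp only [mul_assoc]
        _ = _ := by
            rw [h2, add_mul, mul_assoc h d, h1, mul_assoc x s, ← pow_succ']
            push_cast
            noncomm_ring
  obtain ⟨P, rfl⟩ : ∃ P, p = P + 1 := ⟨p - 1, by omega⟩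
  have := key P
  rw [← mul_assoc h, hph, zero_mul, add_zero] at this
  exact this.symm

/-- Action of the localized algebra on the localized module. -/
noncomputable def locAct (Z A M : Type*) [CommRing Z] [Ring A] [Algebra Z A] [AddCommGroup M]
    [Module A M] [Module Z M] [IsScalarTower Z A M] (S : Submonoid Z) :
    (Localization S ⊗[Z] A) →ₐ[Localization S]
      Module.End (Localization S) (LocalizedModule S M) :=
  Algebra.TensorProduct.lift (Algebra.ofId _ _)
    (AlgHom.ofLinearMap
      ((LocalizedModule.map S).restrictScalars Z ∘ₗ (Algebra.lsmul Z Z M).toLinearMap)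
      (by
        ext x
        induction x using LocalizedModule.induction_on with | _ m s
        simp [LocalizedModule.map_mk])
      (by
        intro a a'
        ext x
        induction x using LocalizedModule.induction_on with | _ m s
        simp [LocalizedModule.map_mk, mul_smul]))
    (fun r a => Algebra.commutes _ _)

theorem locAct_one_tmul {Z A M : Type*} [CommRing Z] [Ring A] [Algebra Z A] [AddCommGroup M]
    [Module A M] [Module Z M] [IsScalarTower Z A M] (S : Submonoid Z) (a : A) (m : M) :
    locAct Z A M S (1 ⊗ₜ a) (LocalizedModule.mk m 1) = LocalizedModule.mk (a • m) 1 := by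
  simp [locAct, LocalizedModule.map_mk]

/-- **Involutivity of the `p`-support.**  Let `A` be an Azumaya algebra of constant rank
`p^{2n}` over its center `Z`, a regular finitely generated commutative algebra over a field
`k` of characteristic `p > 0`.  Let `(A', h, π)` be a first order deformation of `A` with
induced bracket `{−,−}` on `Z`, and let `M` be a finitely generated `A`-module admitting a
first order `A'`-deformation, such that at every generic point of its support the length of
`M` is `b·p^n` with `p ∤ b`.  Then `I = rad(Ann_Z M)` is coisotropic: `{I, I} ⊆ I`. -/
theorem p_support_involutive {k : Type*} [Field k] (p : ℕ) (hp : p.Prime) [CharP k p]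
    {A : Type*} [Ring A] [Algebra k A]
    {Z : Type*} [CommRing Z] [Algebra k Z] [Algebra Z A] [IsScalarTower k Z A]
    -- `Z` is (identified with) the center of `A`
    (hinj : Function.Injective (algebraMap Z A))
    (hcenter : (algebraMap Z A).range = Subring.center A)
    -- `Z` is a finitely generated `k`-algebra which is regular
    (hfg : Algebra.FiniteType k Z)
    (hreg : ∀ (q : Ideal Z) (hq : q.IsPrime), IsRegularLocalRingPred (Localization.AtPrime q))
    -- `A` is Azumaya over `Z` of constant rank `(p^n)² = p^{2n}`
    (haz : IsAzumayaOver Z A)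
    (n : ℕ) (hrank : ∀ P : PrimeSpectrum Z, Module.rankAtStalk A P = (p ^ n) ^ 2)
    -- a first order deformation of `A` and the induced bracket on `Z`
    {A' : Type*} [Ring A'] (h : A') (π : A' →+* A) (hdef : IsFirstOrderDeformation h π)
    (br : Z → Z → Z)
    (hbr : ∀ (a b : Z) (atil btil c : A'), π atil = algebraMap Z A a →
      π btil = algebraMap Z A b → atil * btil - btil * atil = h * c →
      π c = algebraMap Z A (br a b))
    -- a finitely generated `A`-module with a first order deformation
    (M : Type*) [AddCommGroup M] [Module A M] [Module.Finite A M]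
    [Module Z M] [IsScalarTower Z A M]
    (M' : Type*) [AddCommGroup M'] [Module A' M'] (q : M' →+ M)
    (hq : IsModuleDeformation h π q)
    -- the multiplicity of `M` at each generic point of its support is `b·pⁿ` with `p ∤ b`
    (hmult : ∀ (Q : Ideal Z) (hQ : Q.IsPrime), Q ∈ (Module.annihilator Z M).minimalPrimes →
      ∃ b : ℕ, ¬ p ∣ b ∧
        HasModuleLength (Localization.AtPrime Q) (LocalizedModule Q.primeCompl M) (b * p ^ n)) :
    ∀ a ∈ (Module.annihilator Z M).radical, ∀ b ∈ (Module.annihilator Z M).radical,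
      br a b ∈ (Module.annihilator Z M).radical := by

  obtain ⟨_, hfin, hproj, _⟩ := id haz
  obtain ⟨hcen, hπ, hker, hann⟩ := id hdef
  obtain ⟨hqs, hqπ, hqk, hqh⟩ := id hq
  have hpZ : (p : Z) = 0 := by
    rw [← map_natCast (algebraMap k Z), CharP.cast_eq_zero, map_zero]
  have hpA : (p : A) = 0 := by
    rw [← map_natCast (algebraMap Z A), hpZ, map_zero]
  have hZc : ∀ z : Z, algebraMap Z A z ∈ Subring.center A := fun z => by
    rw [← hcenter]; exact ⟨z, rfl⟩
  -- the map from the center of `A'` to `Z`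
  have hcθ : ∀ c : Subring.center A', ∃ z : Z, algebraMap Z A z = π c := by
    intro c
    have h1 : π c ∈ Subring.center A := by
      rw [Subring.mem_center_iff]
      intro x
      obtain ⟨y, rfl⟩ := hπ x
      rw [← map_mul, ← map_mul, Subring.mem_center_iff.mp c.2 y]
    rw [← hcenter] at h1
    exact h1
  choose t ht using hcθ
  let θ : Subring.center A' →+* Z :=
    { toFun := t
      map_one' := hinj (by rw [ht]; simp)
      map_mul' := fun x y => hinj (by rw [map_mul, ht, ht, ht]; simp)
      map_zero' := hinj (by rw [ht]; simp)
      map_add' := fun x y => hinj (by rw [map_add, ht, ht, ht]; simp) }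
  have hθ : ∀ c, algebraMap Z A (θ c) = π c := ht
  have hθp : ∀ s : Z, ∃ c, θ c = s ^ p := by
    intro s
    obtain ⟨s', hs'⟩ := hπ (algebraMap Z A s)
    refine ⟨⟨s' ^ p, center_pow h π hdef p hp.pos hpA s' (hs' ▸ hZc s)⟩, hinj ?_⟩
    rw [hθ, map_pow, map_pow, hs']
  intro z₁ hz₁ z₂ hz₂
  rw [← Ideal.sInf_minimalPrimes, Submodule.mem_sInf] at hz₁ hz₂ ⊢
  intro (Q : Ideal Z) hQmem
  have hQ : Q.IsPrime := hQmem.1.1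
  by_contra hcon
  obtain ⟨b, hb, hlen⟩ := hmult Q hQ hQmem
  have h1Q := hz₁ Q hQmem
  have h2Q := hz₂ Q hQmem
  obtain ⟨a₁, ha₁⟩ := hπ (algebraMap Z A z₁)
  obtain ⟨a₂, ha₂⟩ := hπ (algebraMap Z A z₂)
  obtain ⟨c, hc⟩ := (hker (a₁ * a₂ - a₂ * a₁)).mp (by
    rw [map_sub, map_mul, map_mul, ha₁, ha₂, ← map_mul, ← map_mul, mul_comm, sub_self])
  have hbrc := hbr z₁ z₂ a₁ a₂ c ha₁ ha₂ hc
  -- localization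
  let R := Localization.AtPrime Q
  let 𝓑 := R ⊗[Z] A
  let L := LocalizedModule Q.primeCompl M
  let _ : Module 𝓑 L := Module.compHom L (locAct Z A M Q.primeCompl).toRingHom
  have hact : ∀ (β : 𝓑) (y : L), β • y = locAct Z A M Q.primeCompl β y := fun _ _ => rfl
  have htow : IsScalarTower R 𝓑 L := ⟨fun r β y => by
    rw [hact, hact, map_smul, LinearMap.smul_apply]⟩
  let _ : Module (Subring.center A') M := Module.compHom M θ
  let _ : Module (Subring.center A') L := Module.compHom L ((algebraMap Z R).comp θ)
  obtain ⟨N, hN⟩ := pow_kills (R := R) (L := L) (by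
    obtain ⟨s, h1, h2, -⟩ := hlen
    exact isFiniteLength_of_exists_compositionSeries ⟨s, h1, h2⟩)
  have hN' : ∀ r ∈ IsLocalRing.maximalIdeal R ^ (N + 1), ∀ w : L, r • w = 0 :=
    fun r hr => hN r (Ideal.pow_le_pow_right (Nat.le_succ N) hr)
  have hrk : Module.finrank Q.ResidueField (Q.ResidueField ⊗[Z] A) = (p ^ n) ^ 2 := by
    rw [← hrank ⟨Q, hQ⟩]
    exact Ideal.finrank_fiber_eq_rankAtStalk Q
  have hnt : Nontrivial (Q.ResidueField ⊗[Z] A) := by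
    apply Module.nontrivial_of_finrank_pos (R := Q.ResidueField)
    rw [hrk]
    have := hp.pos
    positivity
  have hsimp := fibre_simple haz Q
  obtain ⟨e, hid, heβ, hle⟩ := exists_good_idem (R := R) (𝓑 := 𝓑)
    (B := Q.ResidueField ⊗[Z] A) (W := L) (fibreMap Z A Q).toRingHom (fibreMap_surj Z A Q)
    (fibreMap_algebraMap Z A Q) (fibreMap_ker Z A Q) hp hb hrk (N + 1) hN'
    (hasModuleLength_length hlen)
  apply hb
  refine conc_loc (C := Subring.center A') (A' := A') (A := A) (Z := Z) (R := R) (𝓑 := 𝓑)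
    (L := L) (M := M) (M' := M') hp ?_ (N + 1) (Nat.succ_ne_zero N) hN' e hid heβ hle
    Q.primeCompl (fun s hs => IsLocalization.map_units R ⟨s, hs⟩)
    (Algebra.TensorProduct.includeRight : A →ₐ[Z] R ⊗[Z] A).toRingHom ?_ ?_ ?_
    (LocalizedModule.mkLinearMap Q.primeCompl M).toAddMonoidHom ?_ ?_ ?_
    h π hcen hπ hker q hqs hqπ hqk hqh (Subring.center A').subtype ?_ θ hθ hθp
    (fun _ _ => rfl) (fun _ _ => rfl) (fun _ _ => rfl) a₁ a₂ c z₁ z₂ (br z₁ z₂) ha₁ ha₂ hbrc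
    ?_ ?_ ?_ hc
  · rw [← map_natCast (algebraMap Z R), hpZ, map_zero]
  · intro β
    obtain ⟨⟨a, s⟩, hs⟩ := IsLocalizedModule.surj Q.primeCompl (TensorProduct.mk Z R A 1) β
    refine ⟨s, s.2, a, ?_⟩
    rw [algebraMap_smul]
    exact hs
  · intro a ha
    obtain ⟨s, hs⟩ := (IsLocalizedModule.eq_zero_iff Q.primeCompl (TensorProduct.mk Z R A 1)).mp ha
    exact ⟨s, s.2, hs⟩
  · intro z
    change (1 : R) ⊗ₜ[Z] algebraMap Z A z = (algebraMap Z R z) ⊗ₜ[Z] (1 : A)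
    rw [Algebra.algebraMap_eq_smul_one, Algebra.algebraMap_eq_smul_one, TensorProduct.smul_tmul]
  · intro a m
    exact (locAct_one_tmul Q.primeCompl a m).symm
  · intro y
    obtain ⟨⟨m, s⟩, hs⟩ := IsLocalizedModule.surj Q.primeCompl
      (LocalizedModule.mkLinearMap Q.primeCompl M) y
    refine ⟨s, s.2, m, ?_⟩
    rw [algebraMap_smul]
    exact hs
  · intro m hm
    obtain ⟨s, hs⟩ := (IsLocalizedModule.eq_zero_iff Q.primeCompl
      (LocalizedModule.mkLinearMap Q.primeCompl M)).mp hm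
    exact ⟨s, s.2, hs⟩
  · intro c a
    exact (Subring.mem_center_iff.mp c.2 a).symm
  · exact (IsLocalization.AtPrime.to_map_mem_maximal_iff R Q z₁).mpr h1Q
  · exact (IsLocalization.AtPrime.to_map_mem_maximal_iff R Q z₂).mpr h2Q
  · exact fun hm => hcon ((IsLocalization.AtPrime.to_map_mem_maximal_iff R Q _).mp hm)
end
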